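/- Let p₁, …, p_k, q₁, …, q_l be distinct odd primes, let a = 4·p₁^{x₁}⋯p_k^{x_k}·q₁^{u₁}⋯q_l^{u_l} and (r₁, r₂, r₃) = (1, p₁^{y₁}⋯p_k^{y_k}, q₁^{v₁}⋯q_l^{v_l}), where x₁, …, x_k, y₁, …, y_k, u₁, …, u_l, v₁, …, v_l are positive integers, and set a₁ = a, a₂ = a+1, a₃ = a+2. Then r₁, r₂, r₃ are pairwise coprime odd positive integers with gcd(rᵢ, aᵢ) = 1 for each i = 1, 2, 3, and consequently the rational number (4/3)·∏_{i=1}^{k} (xᵢ+1)(yᵢ+1)/(xᵢ+yᵢ+1) · ∏_{i=1}^{l} (uᵢ+vᵢ+1)/((uᵢ+1)(vᵢ+1)) belongs to R, the set of values attained infinitely many times by the sequence d(n+1)/d(n). -/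

import Mathlib

/-- `d n` is the number of positive divisors of `n`. -/
def d (n : ℕ) : ℕ := n.divisors.card

/-- `R` is the set of (rational) values attained infinitely many times by the
sequence `d(n+1)/d(n)` over positive integers `n`. -/
def R : Set ℚ :=
  {q | {n : ℕ | 0 < n ∧ (d (n + 1) : ℚ) / (d n : ℚ) = q}.Infinite}

theorem sum_inv_primes_le_harmonic (J : ℕ) :
    ∑ p ∈ (Finset.range (2 ^ (J + 1) + 1)).filter Nat.Prime, (1 / p : ℝ) ≤
      1 / 2 + 4 * ∑ k ∈ Finset.range J, (1 / ((k : ℝ) + 1)) := by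
  induction J with
  | zero =>
    have : (Finset.range (2 ^ (0 + 1) + 1)).filter Nat.Prime = {2} := by decide
    rw [this]; simp
  | succ J ih =>
    set A := (Finset.range (2 ^ (J + 1) + 1)).filter Nat.Prime with hA
    set B := (Finset.range (2 ^ (J + 1 + 1) + 1)).filter Nat.Prime with hB
    have hAB : A ⊆ B := by
      intro p
      simp only [hA, hB, Finset.mem_filter, Finset.mem_range]
      rintro ⟨h1, h2⟩
      refine ⟨?_, h2⟩
      have : 2 ^ (J + 1) ≤ 2 ^ (J + 1 + 1) := Nat.pow_le_pow_right (by norm_num) (by lia)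
      lia
    have hlow : ∀ p ∈ B \ A, 2 ^ (J + 1) ≤ p := by
      intro p
      simp only [hA, hB, Finset.mem_sdiff, Finset.mem_filter, Finset.mem_range]
      rintro ⟨⟨_, h2⟩, h3⟩
      by_contra h
      exact h3 ⟨by lia, h2⟩
    have hcard : (J + 1) * (B \ A).card ≤ 2 ^ (J + 3) := by
      have h1 : (2 ^ (J + 1)) ^ (B \ A).card ≤ ∏ p ∈ B \ A, p :=
        Finset.pow_card_le_prod _ _ _ hlow
      have h2 : ∏ p ∈ B \ A, p ≤ ∏ p ∈ B, p := by
        apply Finset.prod_le_prod_of_subset_of_one_le' Finset.sdiff_subset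
        intro p hp _
        exact (Finset.mem_filter.1 hp).2.one_le
      have h3 : ∏ p ∈ B, p ≤ 4 ^ (2 ^ (J + 1 + 1)) := primorial_le_four_pow _
      have h4 : (2 : ℕ) ^ ((J + 1) * (B \ A).card) ≤ 2 ^ (2 ^ (J + 3)) := by
        rw [pow_mul]
        refine (h1.trans (h2.trans h3)).trans (le_of_eq ?_)
        rw [show (4 : ℕ) = 2 ^ 2 by norm_num, ← pow_mul]
        congr 1
        ring
      exact (Nat.pow_le_pow_iff_right (by norm_num)).1 h4
    have hsum : ∑ p ∈ B \ A, (1 / p : ℝ) ≤ 4 * (1 / ((J : ℝ) + 1)) := by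
      calc ∑ p ∈ B \ A, (1 / p : ℝ) ≤ ∑ p ∈ B \ A, (1 / 2 ^ (J + 1) : ℝ) := by
            apply Finset.sum_le_sum
            intro p hp
            apply one_div_le_one_div_of_le (by positivity)
            exact_mod_cast hlow p hp
        _ = (B \ A).card * (1 / 2 ^ (J + 1) : ℝ) := by simp
        _ ≤ 4 * (1 / ((J : ℝ) + 1)) := by
            have : ((J : ℝ) + 1) * (B \ A).card ≤ 2 ^ (J + 3) := by exact_mod_cast hcard
            rw [mul_one_div, mul_one_div, div_le_div_iff₀ (by positivity) (by positivity)]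
            calc _ = ((J : ℝ) + 1) * (B \ A).card := by ring
              _ ≤ _ := this
              _ = _ := by ring
    rw [← Finset.sum_sdiff hAB, Finset.sum_range_succ]
    linarith

theorem sum_inv_primes_le_log (J : ℕ) (hJ : 1 ≤ J) :
    ∑ p ∈ (Finset.range (2 ^ J + 1)).filter Nat.Prime, (1 / p : ℝ) ≤ 5 + 4 * Real.log J := by
  obtain ⟨K, rfl⟩ : ∃ K, J = K + 1 := ⟨J - 1, by lia⟩
  refine (sum_inv_primes_le_harmonic K).trans ?_
  have h := harmonic_le_one_add_log K
  have h2 : ((harmonic K : ℚ) : ℝ) = ∑ k ∈ Finset.range K, (1 / ((k : ℝ) + 1)) := by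
    simp [harmonic]
  rw [h2] at h
  have h3 : Real.log K ≤ Real.log ((K + 1 : ℕ) : ℝ) := by
    rcases Nat.eq_zero_or_pos K with rfl | hK
    · simp
    · exact Real.log_le_log (by exact_mod_cast hK) (by push_cast; linarith)
  linarith

theorem exists_dvd_linear_iff_modEq {b q d : ℕ} (hd : 0 < d) (hq : q.Coprime d) :
    ∃ r, ∀ x, d ∣ b + q * x ↔ x ≡ r [MOD d] := by
  have : NeZero d := ⟨hd.ne'⟩
  refine ⟨((-(b : ZMod d) * (q : ZMod d)⁻¹)).val, fun x => ?_⟩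
  have hu : (q : ZMod d) * (q : ZMod d)⁻¹ = 1 := ZMod.coe_mul_inv_eq_one q hq
  rw [← ZMod.natCast_eq_zero_iff, ← ZMod.natCast_eq_natCast_iff, ZMod.natCast_zmod_val]
  push_cast
  constructor
  · intro h
    linear_combination (q : ZMod d)⁻¹ * h - (x : ZMod d) * hu
  · intro h
    linear_combination (q : ZMod d) * h - (b : ZMod d) * hu

theorem abs_card_dvd_linear_sub_le {b q d : ℕ} (hd : 0 < d) (hq : q.Coprime d) (T : ℕ) :
    |(((Finset.range T).filter (fun x => d ∣ b + q * x)).card : ℝ) - T / d| ≤ 1 := by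
  obtain ⟨r, hr⟩ := exists_dvd_linear_iff_modEq (b := b) hd hq
  have h1 : ((Finset.range T).filter (fun x => d ∣ b + q * x)).card
      = T / d + if r % d < T % d then 1 else 0 := by
    rw [← Nat.count_modEq_card _ hd, Nat.count_eq_card_filter_range]
    simp only [hr]
  have h2 : (T : ℝ) = d * ((T / d : ℕ) : ℝ) + ((T % d : ℕ) : ℝ) := by
    exact_mod_cast (Nat.div_add_mod T d).symm
  have h3 : ((T % d : ℕ) : ℝ) < d := by exact_mod_cast Nat.mod_lt T hd
  have h4 : (0 : ℝ) ≤ ((T % d : ℕ) : ℝ) := by positivity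
  have hd' : (0 : ℝ) < d := by exact_mod_cast hd
  have h5 : (T : ℝ) / d = ((T / d : ℕ) : ℝ) + ((T % d : ℕ) : ℝ) / d := by
    rw [h2]; field_simp
  have h6 : ((T % d : ℕ) : ℝ) / d ≤ 1 := by rw [div_le_one hd']; exact h3.le
  have h7 : (0 : ℝ) ≤ ((T % d : ℕ) : ℝ) / d := by positivity
  rw [h1, h5, abs_le]
  push_cast
  split_ifs <;> constructor <;> linarith

/-- A Turán-type variance bound for the number of prime divisors, taken from a finite set of
primes, of the values of a linear form. -/
theorem sum_sq_card_prime_dvd_linear_sub_le {b q : ℕ} (S : Finset ℕ)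
    (hS : ∀ p ∈ S, p.Prime ∧ q.Coprime p) (T : ℕ) :
    ∑ x ∈ Finset.range T,
        (((S.filter (fun p => p ∣ b + q * x)).card : ℝ) - ∑ p ∈ S, (1 / p : ℝ)) ^ 2 ≤
      T * ∑ p ∈ S, (1 / p : ℝ) + 3 * (S.card : ℝ) ^ 2 := by
  set μ := ∑ p ∈ S, (1 / p : ℝ) with hμ
  set K := (S.card : ℝ) with hK
  have hμ0 : 0 ≤ μ := Finset.sum_nonneg fun p _ => by positivity
  have hμK : μ ≤ K := by
    calc μ ≤ ∑ p ∈ S, (1 : ℝ) := by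
          apply Finset.sum_le_sum
          intro p hp
          have : (1 : ℝ) ≤ p := by exact_mod_cast (hS p hp).1.one_le
          rw [div_le_one (by linarith)]; exact this
      _ = K := by simp [hK]
  have hw : ∀ x, ((S.filter (fun p => p ∣ b + q * x)).card : ℝ)
      = ∑ p ∈ S, if p ∣ b + q * x then (1 : ℝ) else 0 := by
    intro x; rw [Finset.card_filter]; push_cast; rfl
  have hcount : ∀ d : ℕ, ∑ x ∈ Finset.range T, (if d ∣ b + q * x then (1 : ℝ) else 0)
      = ((Finset.range T).filter (fun x => d ∣ b + q * x)).card := by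
    intro d; rw [Finset.card_filter]; push_cast; rfl
  have h1 : T * μ - K ≤ ∑ x ∈ Finset.range T, ((S.filter (fun p => p ∣ b + q * x)).card : ℝ) := by
    simp_rw [hw]
    rw [Finset.sum_comm, hμ, hK, Finset.mul_sum, Finset.card_eq_sum_ones]
    push_cast
    rw [← Finset.sum_sub_distrib]
    apply Finset.sum_le_sum
    intro p hp
    rw [hcount]
    have := abs_le.1 (abs_card_dvd_linear_sub_le (b := b) (hS p hp).1.pos (hS p hp).2 T)
    rw [mul_one_div]
    linarith [this.1]
  have h2 : ∑ x ∈ Finset.range T, ((S.filter (fun p => p ∣ b + q * x)).card : ℝ) ^ 2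
      ≤ T * μ ^ 2 + K ^ 2 + T * μ := by
    have e1 : ∀ x, ((S.filter (fun p => p ∣ b + q * x)).card : ℝ) ^ 2
        = ∑ p ∈ S, ∑ r ∈ S, (if p ∣ b + q * x ∧ r ∣ b + q * x then (1 : ℝ) else 0) := by
      intro x
      rw [hw, sq, Finset.sum_mul_sum]
      refine Finset.sum_congr rfl fun p _ => Finset.sum_congr rfl fun r _ => ?_
      split_ifs <;> simp_all
    simp_rw [e1]
    rw [Finset.sum_comm]
    simp_rw [Finset.sum_comm (s := Finset.range T)]
    have e2 : ∀ p ∈ S, ∀ r ∈ S,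
        ∑ x ∈ Finset.range T, (if p ∣ b + q * x ∧ r ∣ b + q * x then (1 : ℝ) else 0)
          ≤ T * ((1 / p) * (1 / r)) + 1 + if p = r then T * (1 / p : ℝ) else 0 := by
      intro p hp r hr
      by_cases hpr : p = r
      · subst hpr
        simp only [and_self, if_true]
        rw [hcount]
        have := abs_le.1 (abs_card_dvd_linear_sub_le (b := b) (hS p hp).1.pos (hS p hp).2 T)
        have h0 : (0 : ℝ) ≤ T * ((1 / p) * (1 / p)) := by positivity
        have h' : (T : ℝ) * (1 / p) = T / p := mul_one_div _ _
        linarith [this.2]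
      · rw [if_neg hpr]
        have hc : p.Coprime r := (Nat.coprime_primes (hS p hp).1 (hS r hr).1).2 hpr
        have e3 : ∀ x, (p ∣ b + q * x ∧ r ∣ b + q * x) ↔ p * r ∣ b + q * x := fun x =>
          ⟨fun h => hc.mul_dvd_of_dvd_of_dvd h.1 h.2,
            fun h => ⟨(dvd_mul_right _ _).trans h, (dvd_mul_left _ _).trans h⟩⟩
        simp_rw [e3]
        rw [hcount]
        have := abs_le.1 (abs_card_dvd_linear_sub_le (b := b) (d := p * r) (q := q)
          (Nat.mul_pos (hS p hp).1.pos (hS r hr).1.pos)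
          (Nat.Coprime.mul_right (hS p hp).2 (hS r hr).2) T)
        have e4 : (T : ℝ) * ((1 / p) * (1 / r)) = T / ((p * r : ℕ) : ℝ) := by
          push_cast; rw [one_div_mul_one_div, mul_one_div]
        linarith [this.2]
    refine (Finset.sum_le_sum fun p hp => Finset.sum_le_sum fun r hr => e2 p hp r hr).trans ?_
    apply le_of_eq
    simp_rw [Finset.sum_add_distrib]
    rw [show μ ^ 2 = (∑ p ∈ S, (1 / p : ℝ)) * ∑ p ∈ S, (1 / p : ℝ) by rw [sq],
      Finset.sum_mul_sum]
    simp_rw [Finset.mul_sum]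
    congr 1
    · congr 1
      simp [hK, sq]
    · rw [hμ, Finset.mul_sum]
      refine Finset.sum_congr rfl fun p hp => ?_
      simp [hp]
  have h3 : ∑ x ∈ Finset.range T, (((S.filter (fun p => p ∣ b + q * x)).card : ℝ) - μ) ^ 2
      = ∑ x ∈ Finset.range T, ((S.filter (fun p => p ∣ b + q * x)).card : ℝ) ^ 2
        - 2 * μ * ∑ x ∈ Finset.range T, ((S.filter (fun p => p ∣ b + q * x)).card : ℝ)
        + T * μ ^ 2 := by
    simp_rw [sub_sq]
    rw [Finset.sum_add_distrib, Finset.sum_sub_distrib, Finset.mul_sum]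
    congr 1
    · congr 1
      refine Finset.sum_congr rfl fun x _ => by ring
    · simp
  rw [h3]
  have hK0 : 0 ≤ K := by positivity
  nlinarith [mul_le_mul_of_nonneg_left h1 hμ0, mul_le_mul_of_nonneg_right hμK hK0]

/-- Distinct natural numbers cannot all be close to a given real number. -/
theorem cube_le_sum_sq_sub_of_injective {N : ℕ} (hN : 8 ≤ N) (f : Fin N → ℕ)
    (hf : Function.Injective f) (μ : ℝ) :
    (N : ℝ) ^ 3 ≤ 128 * ∑ i, ((f i : ℝ) - μ) ^ 2 := by
  set near := Finset.univ.filter (fun i => |(f i : ℝ) - μ| < N / 8) with hnear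
  set far := Finset.univ.filter (fun i => ¬ |(f i : ℝ) - μ| < N / 8) with hfar
  have hN' : (8 : ℝ) ≤ N := by exact_mod_cast hN
  have hcard : (near.card : ℝ) ≤ N / 4 + 1 := by
    have h1 : near.card ≤ (Finset.Icc ⌈μ - N / 8⌉ ⌊μ + N / 8⌋).card := by
      apply Finset.card_le_card_of_injOn (fun i => (f i : ℤ))
      · intro i hi
        have hi' := abs_lt.1 (Finset.mem_filter.1 hi).2
        simp only [Finset.coe_Icc, Set.mem_Icc, Int.ceil_le, Int.le_floor]
        push_cast
        constructor <;> linarith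
      · intro i _ j _ hij
        exact hf (Int.ofNat_inj.1 hij)
    have h2 : ((Finset.Icc ⌈μ - N / 8⌉ ⌊μ + N / 8⌋).card : ℤ) ≤ max (⌊μ + N / 8⌋ + 1 - ⌈μ - N / 8⌉) 0 := by
      simp [Int.card_Icc]
    have h3 : ((max (⌊μ + N / 8⌋ + 1 - ⌈μ - N / 8⌉) 0 : ℤ) : ℝ) ≤ N / 4 + 1 := by
      push_cast
      apply max_le
      · linarith [Int.floor_le (μ + N / 8), Int.le_ceil (μ - N / 8)]
      · linarith
    have h4 : (near.card : ℤ) ≤ max (⌊μ + N / 8⌋ + 1 - ⌈μ - N / 8⌉) 0 :=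
      le_trans (by exact_mod_cast h1) h2
    calc (near.card : ℝ) = ((near.card : ℤ) : ℝ) := by simp
      _ ≤ _ := by exact_mod_cast h4
      _ ≤ _ := h3
  have hsplit : (near.card : ℝ) + far.card = N := by
    have := Finset.card_filter_add_card_filter_not (s := (Finset.univ : Finset (Fin N)))
      (fun i => |(f i : ℝ) - μ| < N / 8)
    rw [Finset.card_univ, Fintype.card_fin] at this
    exact_mod_cast this
  have hfarcard : 5 * (N : ℝ) / 8 ≤ far.card := by linarith
  have hsum : far.card * ((N : ℝ) / 8) ^ 2 ≤ ∑ i, ((f i : ℝ) - μ) ^ 2 := by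
    calc far.card * ((N : ℝ) / 8) ^ 2 = ∑ i ∈ far, ((N : ℝ) / 8) ^ 2 := by simp
      _ ≤ ∑ i ∈ far, ((f i : ℝ) - μ) ^ 2 := by
          apply Finset.sum_le_sum
          intro i hi
          have hi' := not_lt.1 (Finset.mem_filter.1 hi).2
          rw [← sq_abs ((f i : ℝ) - μ)]
          exact pow_le_pow_left₀ (by positivity) hi' 2
      _ ≤ _ := Finset.sum_le_sum_of_subset_of_nonneg (Finset.subset_univ _)
          fun _ _ _ => sq_nonneg _
  have : 5 * (N : ℝ) / 8 * ((N : ℝ) / 8) ^ 2 ≤ far.card * ((N : ℝ) / 8) ^ 2 := by gcongr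
  have h0 : 0 ≤ (N : ℝ) ^ 3 := by positivity
  nlinarith

theorem card_divisors_of_squarefree {n : ℕ} (hn : Squarefree n) :
    n.divisors.card = 2 ^ n.primeFactors.card := by
  rw [Nat.card_divisors hn.ne_zero, Finset.card_eq_sum_ones, ← Finset.prod_pow_eq_pow_sum]
  refine Finset.prod_congr rfl fun p hp => ?_
  rw [Nat.factorization_eq_one_of_squarefree hn (Nat.prime_of_mem_primeFactors hp)
    (Nat.dvd_of_mem_primeFactors hp), pow_one]

theorem card_not_squarefree_linear_le {b q z M T : ℕ} (hz : 1 ≤ z)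
    (hpos : ∀ x < T, 0 < b + q * x) (hlt : ∀ x < T, b + q * x ≤ M ^ 2)
    (hcop : ∀ p, p.Prime → p ∣ q → ∀ x, ¬ p ∣ b + q * x)
    (hsmall : ∀ p, p.Prime → p ≤ z → p ∣ q) :
    (((Finset.range T).filter (fun x => ¬ Squarefree (b + q * x))).card : ℝ) ≤ T / z + M := by
  set S := (Finset.Ioc z M).filter (fun p => p.Prime ∧ ¬ p ∣ q) with hS
  have hsub : (Finset.range T).filter (fun x => ¬ Squarefree (b + q * x)) ⊆
      S.biUnion (fun p => (Finset.range T).filter (fun x => p ^ 2 ∣ b + q * x)) := by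
    intro x hx
    rw [Finset.mem_filter, Finset.mem_range] at hx
    obtain ⟨hxT, hx⟩ := hx
    rw [Nat.squarefree_iff_prime_squarefree] at hx
    push Not at hx
    obtain ⟨p, hp, hpx⟩ := hx
    have hpq : ¬ p ∣ q := fun h => hcop p hp h x ((dvd_mul_right _ _).trans hpx)
    have hpM : p * p ≤ M ^ 2 := (Nat.le_of_dvd (hpos x hxT) hpx).trans (hlt x hxT)
    refine Finset.mem_biUnion.2 ⟨p, ?_, ?_⟩
    · rw [hS, Finset.mem_filter, Finset.mem_Ioc]
      refine ⟨⟨?_, ?_⟩, hp, hpq⟩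
      · by_contra h
        exact hpq (hsmall p hp (by lia))
      · nlinarith
    · rw [Finset.mem_filter, Finset.mem_range, sq]
      exact ⟨hxT, hpx⟩
  have h1 : ((Finset.range T).filter (fun x => ¬ Squarefree (b + q * x))).card ≤
      ∑ p ∈ S, ((Finset.range T).filter (fun x => p ^ 2 ∣ b + q * x)).card :=
    (Finset.card_le_card hsub).trans Finset.card_biUnion_le
  have h2 : ∀ p ∈ S, (((Finset.range T).filter (fun x => p ^ 2 ∣ b + q * x)).card : ℝ) ≤
      T * ((p : ℝ) ^ 2)⁻¹ + 1 := by
    intro p hp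
    obtain ⟨_, hpp, hpq⟩ := Finset.mem_filter.1 hp
    have hc : q.Coprime (p ^ 2) := ((hpp.coprime_iff_not_dvd.2 hpq).symm).pow_right 2
    have := abs_le.1 (abs_card_dvd_linear_sub_le (b := b) (pow_pos hpp.pos 2) hc T)
    push_cast at this
    rw [← div_eq_mul_inv]
    linarith [this.2]
  have h3 : ∑ p ∈ S, ((p : ℝ) ^ 2)⁻¹ ≤ 1 / z := by
    rcases le_or_gt z M with hzM | hzM
    · calc ∑ p ∈ S, ((p : ℝ) ^ 2)⁻¹ ≤ ∑ p ∈ Finset.Ioc z M, ((p : ℝ) ^ 2)⁻¹ :=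
            Finset.sum_le_sum_of_subset_of_nonneg (Finset.filter_subset _ _)
              fun _ _ _ => by positivity
        _ ≤ (z : ℝ)⁻¹ - (M : ℝ)⁻¹ := sum_Ioc_inv_sq_le_sub (by lia) hzM
        _ ≤ 1 / z := by
            have : (0 : ℝ) ≤ (M : ℝ)⁻¹ := by positivity
            rw [one_div]; linarith
    · have : S = ∅ := by rw [hS, Finset.Ioc_eq_empty (by lia)]; rfl
      rw [this]; simp
  have h4 : (S.card : ℝ) ≤ M := by
    have : S.card ≤ M := (Finset.card_filter_le _ _).trans (by simp)
    exact_mod_cast this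
  calc (((Finset.range T).filter (fun x => ¬ Squarefree (b + q * x))).card : ℝ)
      ≤ ∑ p ∈ S, (((Finset.range T).filter (fun x => p ^ 2 ∣ b + q * x)).card : ℝ) := by
        exact_mod_cast h1
    _ ≤ ∑ p ∈ S, (T * ((p : ℝ) ^ 2)⁻¹ + 1) := Finset.sum_le_sum h2
    _ = T * ∑ p ∈ S, ((p : ℝ) ^ 2)⁻¹ + S.card := by
        rw [Finset.sum_add_distrib, Finset.mul_sum]; simp
    _ ≤ T * (1 / z) + M := by gcongr
    _ = T / z + M := by rw [mul_one_div]

theorem card_large_primeFactors_le {n y k : ℕ} (hy : 2 ≤ y) (hn : n ≠ 0) (h : n ≤ y ^ k) :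
    (n.primeFactors.filter (fun p => ¬ p ≤ y)).card ≤ k := by
  set S := n.primeFactors.filter (fun p => ¬ p ≤ y) with hS
  have h1 : y ^ S.card ≤ ∏ p ∈ S, p := Finset.pow_card_le_prod _ _ _ fun p hp => by
    have := (Finset.mem_filter.1 hp).2; lia
  have h2 : ∏ p ∈ S, p ≤ ∏ p ∈ n.primeFactors, p :=
    Finset.prod_le_prod_of_subset_of_one_le' (Finset.filter_subset _ _)
      fun p hp _ => (Nat.prime_of_mem_primeFactors hp).one_le
  have h3 : ∏ p ∈ n.primeFactors, p ≤ n :=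
    Nat.le_of_dvd (Nat.pos_of_ne_zero hn) (Nat.prod_primeFactors_dvd n)
  exact (Nat.pow_le_pow_iff_right (by lia)).1 (h1.trans (h2.trans (h3.trans h)))

/-- Among sufficiently many linear forms whose coefficients are not too large, two take
simultaneously values with the same number of divisors. -/
theorem exists_linear_forms_card_divisors_eq {N J Q : ℕ} (hN : 8 ≤ N) (hJ : N ≤ J) (b q : Fin N → ℕ)
    (hb : ∀ i, b i ≤ 2 ^ J) (hb0 : ∀ i, 0 < b i) (hq : ∀ i, q i ≤ 2 ^ J)
    (hQb : ∀ i p, p.Prime → p ∣ Q → ¬ p ∣ b i)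
    (hQq : ∀ i p, p.Prime → (p ∣ Q ↔ p ∣ q i))
    (hsmall : ∀ p, p.Prime → p ≤ 4 * N → p ∣ Q)
    (hlarge : 128 * (4 * (5 + 4 * Real.log J) + 36) < (N : ℝ) ^ 2) :
    ∃ x, ∃ i j, i < j ∧ d (b i + q i * x) = d (b j + q j * x) := by
  set y := 2 ^ J with hy
  set T := 2 ^ (3 * J) with hT
  have hy8 : 8 * N ≤ y := by
    have h1 : N < 2 ^ N := Nat.lt_two_pow_self
    have h2 : ∀ n, 8 ≤ n → 8 * n ≤ 2 ^ n := by
      intro n hn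
      induction n, hn using Nat.le_induction with
      | base => norm_num
      | succ n hn ih => rw [pow_succ]; lia
    exact (h2 N hN).trans (Nat.pow_le_pow_right (by norm_num) hJ)
  have hTy : T = y ^ 3 := by rw [hT, hy, ← pow_mul]; ring_nf
  set S := (Finset.range (y + 1)).filter (fun p => p.Prime ∧ ¬ p ∣ Q) with hS
  set μ := ∑ p ∈ S, (1 / p : ℝ) with hμ
  have hμ0 : 0 ≤ μ := Finset.sum_nonneg fun p _ => by positivity
  have hμle : μ ≤ 5 + 4 * Real.log J := by
    refine le_trans ?_ (sum_inv_primes_le_log J (by lia))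
    apply Finset.sum_le_sum_of_subset_of_nonneg
    · intro p hp
      rw [Finset.mem_filter] at hp ⊢
      exact ⟨hp.1, hp.2.1⟩
    · intro p _ _; positivity
  have hcop : ∀ i p, p.Prime → p ∣ q i → ∀ x, ¬ p ∣ b i + q i * x := by
    intro i p hp hpq x h
    exact hQb i p hp ((hQq i p hp).2 hpq)
      ((Nat.dvd_add_left (hpq.mul_right x)).1 h)
  have hval : ∀ i, ∀ x < T, b i + q i * x ≤ y ^ 4 := by
    intro i x hx
    have h1 : q i * x ≤ y * (T - 1) := Nat.mul_le_mul (hq i) (by lia)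
    have h2 : 1 ≤ T := Nat.one_le_two_pow
    obtain ⟨T', hT'⟩ : ∃ T', T = T' + 1 := ⟨T - 1, by lia⟩
    rw [hT', Nat.add_sub_cancel] at h1
    have h3 : y ^ 4 = y * T' + y := by
      rw [show y ^ 4 = y * y ^ 3 by ring, ← hTy, hT']; ring
    have := hb i
    lia
  have hpos : ∀ i, ∀ x, 0 < b i + q i * x := fun i x => by have := hb0 i; lia
  -- the set of arguments at which some form is not squarefree is small
  set bad := (Finset.range T).filter (fun x => ∃ i, ¬ Squarefree (b i + q i * x)) with hbad
  have hTpos : (0 : ℝ) < T := by rw [hT]; positivity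
  have hN' : (8 : ℝ) ≤ N := by exact_mod_cast hN
  have hyR : 8 * (N : ℝ) ≤ y := by exact_mod_cast hy8
  have hTR : (T : ℝ) = (y : ℝ) ^ 3 := by exact_mod_cast hTy
  have hbadcard : (bad.card : ℝ) ≤ T / 2 := by
    have hsub : bad ⊆ (Finset.univ : Finset (Fin N)).biUnion
        (fun i => (Finset.range T).filter (fun x => ¬ Squarefree (b i + q i * x))) := by
      intro x hx
      obtain ⟨hx1, i, hx2⟩ := Finset.mem_filter.1 hx
      exact Finset.mem_biUnion.2 ⟨i, Finset.mem_univ _, Finset.mem_filter.2 ⟨hx1, hx2⟩⟩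
    have h1 : bad.card ≤ ∑ i : Fin N,
        ((Finset.range T).filter (fun x => ¬ Squarefree (b i + q i * x))).card :=
      (Finset.card_le_card hsub).trans Finset.card_biUnion_le
    have h2 : ∀ i : Fin N,
        (((Finset.range T).filter (fun x => ¬ Squarefree (b i + q i * x))).card : ℝ) ≤
          T / ((4 * N : ℕ) : ℝ) + ((y ^ 2 : ℕ) : ℝ) := fun i =>
      card_not_squarefree_linear_le (by lia) (fun x _ => hpos i x)
        (fun x hx => by rw [← pow_mul]; exact hval i x hx) (hcop i)
        (fun p hp hpz => (hQq i p hp).1 (hsmall p hp hpz))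
    calc (bad.card : ℝ) ≤ ∑ i : Fin N,
          (((Finset.range T).filter (fun x => ¬ Squarefree (b i + q i * x))).card : ℝ) := by
            exact_mod_cast h1
      _ ≤ ∑ i : Fin N, (T / ((4 * N : ℕ) : ℝ) + ((y ^ 2 : ℕ) : ℝ)) :=
          Finset.sum_le_sum fun i _ => h2 i
      _ = T / 4 + N * (y : ℝ) ^ 2 := by
          simp only [Finset.sum_const, Finset.card_univ, Fintype.card_fin, nsmul_eq_mul]
          push_cast
          field_simp
      _ ≤ T / 2 := by
          rw [hTR]
          nlinarith [sq_nonneg (y : ℝ)]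
  set good := (Finset.range T).filter (fun x => ¬ ∃ i, ¬ Squarefree (b i + q i * x)) with hgood
  have hgoodcard : (T : ℝ) / 2 ≤ good.card := by
    have := Finset.card_filter_add_card_filter_not (s := Finset.range T)
      (fun x => ∃ i, ¬ Squarefree (b i + q i * x))
    rw [Finset.card_range] at this
    have h' : (bad.card : ℝ) + good.card = T := by exact_mod_cast this
    linarith
  set w : Fin N → ℕ → ℝ := fun i x => ((S.filter (fun p => p ∣ b i + q i * x)).card : ℝ) with hw
  have hvar : ∑ x ∈ good, ∑ i, (w i x - μ) ^ 2 ≤ N * (T * (μ + 1)) := by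
    have h1 : ∀ i, ∑ x ∈ Finset.range T, (w i x - μ) ^ 2 ≤ T * (μ + 1) := by
      intro i
      refine (sum_sq_card_prime_dvd_linear_sub_le S (fun p hp => ?_) T).trans ?_
      · obtain ⟨_, hp1, hp2⟩ := Finset.mem_filter.1 hp
        exact ⟨hp1, (hp1.coprime_iff_not_dvd.2 fun h => hp2 ((hQq i p hp1).2 h)).symm⟩
      · have h2 : (S.card : ℝ) ≤ y + 1 := by
          have : S.card ≤ y + 1 := (Finset.card_filter_le _ _).trans (by simp)
          exact_mod_cast this
        have h3 : (S.card : ℝ) ^ 2 ≤ (y + 1 : ℝ) ^ 2 := pow_le_pow_left₀ (by positivity) h2 2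
        have h4 : 3 * (y + 1 : ℝ) ^ 2 ≤ T := by rw [hTR]; nlinarith [sq_nonneg (y : ℝ)]
        rw [← hμ]
        linarith
    calc ∑ x ∈ good, ∑ i, (w i x - μ) ^ 2 ≤ ∑ x ∈ Finset.range T, ∑ i, (w i x - μ) ^ 2 :=
          Finset.sum_le_sum_of_subset_of_nonneg (Finset.filter_subset _ _)
            fun _ _ _ => Finset.sum_nonneg fun _ _ => sq_nonneg _
      _ = ∑ i, ∑ x ∈ Finset.range T, (w i x - μ) ^ 2 := Finset.sum_comm
      _ ≤ ∑ i : Fin N, T * (μ + 1) := Finset.sum_le_sum fun i _ => h1 i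
      _ = N * (T * (μ + 1)) := by simp
  obtain ⟨x, hx, hxv⟩ : ∃ x ∈ good, ∑ i, (w i x - μ) ^ 2 ≤ 2 * N * (μ + 1) := by
    by_contra! hcon
    have hne : good.Nonempty := by
      rw [← Finset.card_pos]
      have : (0 : ℝ) < good.card := by linarith
      exact_mod_cast this
    have h1 := Finset.sum_lt_sum_of_nonempty hne hcon
    rw [Finset.sum_const, nsmul_eq_mul] at h1
    have h2 : (T : ℝ) / 2 * (2 * N * (μ + 1)) ≤ good.card * (2 * N * (μ + 1)) := by gcongr
    nlinarith
  obtain ⟨hxT, hxs⟩ := Finset.mem_filter.1 hx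
  rw [Finset.mem_range] at hxT
  push Not at hxs
  set f : Fin N → ℕ := fun i => (b i + q i * x).primeFactors.card with hf
  have hfw : ∀ i, w i x ≤ f i ∧ (f i : ℝ) ≤ w i x + 4 := by
    intro i
    have h1 := Finset.card_filter_add_card_filter_not (s := (b i + q i * x).primeFactors)
      (fun p => p ≤ y)
    have h2 := card_large_primeFactors_le (y := y) (k := 4) (by lia) (hpos i x).ne' (hval i x hxT)
    have h3 : (b i + q i * x).primeFactors.filter (fun p => p ≤ y)
        = S.filter (fun p => p ∣ b i + q i * x) := by
      ext p
      simp only [Finset.mem_filter, Nat.mem_primeFactors, hS, Finset.mem_range]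
      constructor
      · rintro ⟨⟨hp, hpd, _⟩, hpy⟩
        exact ⟨⟨by lia, hp, fun h => hcop i p hp ((hQq i p hp).1 h) x hpd⟩, hpd⟩
      · rintro ⟨⟨hpy, hp, _⟩, hpd⟩
        exact ⟨⟨hp, hpd, (hpos i x).ne'⟩, by lia⟩
    rw [h3] at h1
    simp only [hw, hf]
    constructor
    · exact_mod_cast (by lia)
    · exact_mod_cast (by lia)
  have hninj : ¬ Function.Injective f := by
    intro hinj
    have h1 := cube_le_sum_sq_sub_of_injective hN f hinj μ
    have h2 : ∑ i, ((f i : ℝ) - μ) ^ 2 ≤ ∑ i, (2 * (w i x - μ) ^ 2 + 32) := by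
      apply Finset.sum_le_sum
      intro i _
      obtain ⟨h3, h4⟩ := hfw i
      nlinarith [sq_nonneg ((w i x - μ) - (f i - w i x))]
    rw [Finset.sum_add_distrib, ← Finset.mul_sum] at h2
    simp only [Finset.sum_const, Finset.card_univ, Fintype.card_fin, nsmul_eq_mul] at h2
    have h5 : (N : ℝ) ^ 3 ≤ N * (128 * (4 * μ + 36)) := by linarith
    have h6 : (N : ℝ) * (128 * (4 * μ + 36)) < N * (N : ℝ) ^ 2 := by
      apply mul_lt_mul_of_pos_left _ (by linarith)
      linarith
    linarith [show (N : ℝ) ^ 3 = N * (N : ℝ) ^ 2 by ring]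
  rw [Function.Injective] at hninj
  push Not at hninj
  obtain ⟨i, j, hij, hne⟩ := hninj
  have hd : ∀ i, d (b i + q i * x) = 2 ^ f i := fun i => card_divisors_of_squarefree (hxs i)
  rcases lt_or_gt_of_ne hne with h | h
  · exact ⟨x, i, j, h, by rw [hd, hd, hij]⟩
  · exact ⟨x, j, i, h, by rw [hd, hd, hij]⟩

theorem exists_injOn_prime {ι : Type*} [DecidableEq ι] (S : Finset ι) {B : ℕ} (hB : 1 ≤ B) :
    ∃ σ : ι → ℕ, Set.InjOn σ S ∧ ∀ s ∈ S, (σ s).Prime ∧ B < σ s ∧ σ s ≤ 2 ^ S.card * B := by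
  induction S using Finset.induction_on generalizing B with
  | empty => exact ⟨fun _ => 0, by simp, by simp⟩
  | insert a S ha ih =>
    obtain ⟨π, hπ, hBπ, hπB⟩ := Nat.exists_prime_lt_and_le_two_mul B (by lia)
    obtain ⟨σ, hinj, hσ⟩ := ih (B := π) hπ.one_le
    have hne : ∀ s ∈ S, s ≠ a := fun s hs h => ha (h ▸ hs)
    refine ⟨Function.update σ a π, ?_, ?_⟩
    · intro s hs t ht hst
      rcases Finset.mem_insert.1 hs with rfl | hs' <;> rcases Finset.mem_insert.1 ht with rfl | ht'
      · rfl
      · rw [Function.update_self, Function.update_of_ne (hne t ht')] at hst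
        exact absurd hst (hσ t ht').2.1.ne
      · rw [Function.update_self, Function.update_of_ne (hne s hs')] at hst
        exact absurd hst (hσ s hs').2.1.ne'
      · rw [Function.update_of_ne (hne s hs'), Function.update_of_ne (hne t ht')] at hst
        exact hinj hs' ht' hst
    · intro s hs
      rw [Finset.card_insert_of_notMem ha]
      rcases Finset.mem_insert.1 hs with rfl | hs'
      · rw [Function.update_self]
        refine ⟨hπ, hBπ, hπB.trans ?_⟩
        gcongr
        rw [pow_succ]
        have := Nat.one_le_two_pow (n := S.card)
        lia
      · rw [Function.update_of_ne (hne s hs')]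
        obtain ⟨h1, h2, h3⟩ := hσ s hs'
        refine ⟨h1, by lia, h3.trans ?_⟩
        calc 2 ^ S.card * π ≤ 2 ^ S.card * (2 * B) := by gcongr
          _ = _ := by ring

theorem exists_forall_modEq {ι : Type*} [DecidableEq ι] (S : Finset ι) (m a : ι → ℕ)
    (hm : ∀ i ∈ S, m i ≠ 0) (hco : Set.Pairwise (S : Set ι) (Function.onFun Nat.Coprime m)) :
    ∃ x, (∀ i ∈ S, x ≡ a i [MOD m i]) ∧ x < ∏ i ∈ S, m i :=
  ⟨Nat.chineseRemainderOfFinset a m S hm hco,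
    (Nat.chineseRemainderOfFinset a m S hm hco).2,
    Nat.chineseRemainderOfFinset_lt_prod a m hm hco⟩

theorem d_mul {m n : ℕ} (h : m.Coprime n) : d (m * n) = d m * d n :=
  h.card_divisors_mul

theorem d_prod {ι : Type*} [DecidableEq ι] (S : Finset ι) (f : ι → ℕ)
    (h : Set.Pairwise (S : Set ι) (Function.onFun Nat.Coprime f)) :
    d (∏ i ∈ S, f i) = ∏ i ∈ S, d (f i) := by
  induction S using Finset.induction_on with
  | empty => simp [d]
  | insert a S ha ih =>
    rw [Finset.prod_insert ha, Finset.prod_insert ha, d_mul, ih]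
    · exact h.mono (by simp)
    · refine Nat.Coprime.prod_right fun i hi => h (by simp) (by simp [hi]) ?_
      rintro rfl
      exact ha hi

theorem d_prod_prime_pow {ι : Type*} [DecidableEq ι] (S : Finset ι) (ϖ e : ι → ℕ)
    (hp : ∀ i ∈ S, (ϖ i).Prime) (hinj : Set.InjOn ϖ S) :
    d (∏ i ∈ S, ϖ i ^ e i) = ∏ i ∈ S, (e i + 1) := by
  rw [d_prod]
  · refine Finset.prod_congr rfl fun i hi => ?_
    rw [d, Nat.divisors_prime_pow (hp i hi), Finset.card_map, Finset.card_range]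
  · intro i hi j hj hij
    exact Nat.Coprime.pow _ _ ((Nat.coprime_primes (hp i hi) (hp j hj)).2
      fun h => hij (hinj hi hj h))

theorem sum_factorization_le {n h : ℕ} (hn : n ≠ 0) (hle : n ≤ 2 ^ h) :
    ∑ p ∈ n.primeFactors, n.factorization p ≤ h := by
  rw [← Nat.pow_le_pow_iff_right (a := 2) (by norm_num), ← Finset.prod_pow_eq_pow_sum]
  refine le_trans ?_ hle
  conv_rhs => rw [← Nat.prod_factorization_pow_eq_self hn]
  rw [Finsupp.prod, Nat.support_factorization]
  exact Finset.prod_le_prod' fun p hp =>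
    Nat.pow_le_pow_left (Nat.prime_of_mem_primeFactors hp).two_le _

theorem exists_coprime_copies {α : Type*} [Fintype α] [DecidableEq α] (X : α → ℕ) {h B : ℕ}
    (hX0 : ∀ a, X a ≠ 0) (hX : ∀ a, X a ≤ 2 ^ h) (hB : 1 ≤ B) :
    ∃ Y : α → ℕ, (∀ a, d (Y a) = d (X a)) ∧ Pairwise (Function.onFun Nat.Coprime Y) ∧
      (∀ a p, p.Prime → p ∣ Y a → B < p) ∧
      ∀ a, Y a ≤ (2 ^ (Fintype.card α * h) * B) ^ h := by
  obtain ⟨σ, hinj, hσ⟩ := exists_injOn_prime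
    (Finset.univ.sigma fun a => (X a).primeFactors) hB
  have hmem : ∀ a, ∀ p ∈ (X a).primeFactors,
      (⟨a, p⟩ : Σ _ : α, ℕ) ∈ Finset.univ.sigma fun a => (X a).primeFactors := by
    intro a p hp
    simpa using hp
  have hcard : (Finset.univ.sigma fun a => (X a).primeFactors).card ≤ Fintype.card α * h := by
    rw [Finset.card_sigma]
    refine (Finset.sum_le_card_nsmul _ _ h fun a _ => ?_).trans (by simp)
    refine le_trans ?_ (sum_factorization_le (hX0 a) (hX a))
    rw [Finset.card_eq_sum_ones]
    refine Finset.sum_le_sum fun p hp => ?_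
    exact (Nat.prime_of_mem_primeFactors hp).factorization_pos_of_dvd (hX0 a)
      (Nat.dvd_of_mem_primeFactors hp)
  have hdvd : ∀ a p, p.Prime →
      p ∣ ∏ r ∈ (X a).primeFactors, σ ⟨a, r⟩ ^ (X a).factorization r →
      ∃ r ∈ (X a).primeFactors, p = σ ⟨a, r⟩ := by
    intro a p hp hpa
    obtain ⟨r, hr, hpr⟩ := (Prime.dvd_finsetProd_iff hp.prime _).1 hpa
    exact ⟨r, hr, (Nat.prime_dvd_prime_iff_eq hp (hσ _ (hmem a r hr)).1).1
      (hp.dvd_of_dvd_pow hpr)⟩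
  refine ⟨fun a => ∏ r ∈ (X a).primeFactors, σ ⟨a, r⟩ ^ (X a).factorization r, ?_, ?_, ?_, ?_⟩
  · intro a
    rw [d_prod_prime_pow, d, Nat.card_divisors (hX0 a)]
    · exact fun r hr => (hσ _ (hmem a r hr)).1
    · intro r hr s hs hrs
      simpa using hinj (hmem a r hr) (hmem a s hs) hrs
  · intro a b hab
    refine Nat.coprime_of_dvd fun p hp hpa hpb => hab ?_
    obtain ⟨r, hr, rfl⟩ := hdvd a p hp hpa
    obtain ⟨s, hs, hrs⟩ := hdvd b _ hp hpb
    exact (Sigma.mk.inj (hinj (hmem a r hr) (hmem b s hs) hrs)).1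
  · intro a p hp hpa
    obtain ⟨r, hr, rfl⟩ := hdvd a p hp hpa
    exact (hσ _ (hmem a r hr)).2.1
  · intro a
    have h1 : 1 ≤ 2 ^ (Fintype.card α * h) * B := Nat.mul_pos (by positivity) hB
    refine le_trans ?_ (Nat.pow_le_pow_right h1 (sum_factorization_le (hX0 a) (hX a)))
    rw [← Finset.prod_pow_eq_pow_sum]
    refine Finset.prod_le_prod' fun r hr => Nat.pow_le_pow_left ?_ _
    refine (hσ _ (hmem a r hr)).2.2.trans ?_
    gcongr
    norm_num

/-- Exponents indexed by `i : Fin N` that increase the ratio of divisor counts for a pair `i < j`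
by the factor `(A + 1) (B + 1) / (A + B + 1)` exactly when `i = s`. -/
def raisingExponent {N : ℕ} (A B : ℕ) (s i : Fin N) : ℕ :=
  if i < s then 0 else if i = s then A + B else A

/-- Exponents indexed by `i : Fin N` that decrease the ratio of divisor counts for a pair `i < j`
by the factor `(A + 1) (B + 1) / (A + B + 1)` exactly when `j = s`. -/
def loweringExponent {N : ℕ} (A B : ℕ) (s i : Fin N) : ℕ :=
  if i < s then A else if i = s then A + B else 0

/-- The factor `(A + 1) (B + 1) / (A + B + 1)`. -/
def ratioFactor (A B : ℕ) : ℚ := ((A + 1) * (B + 1)) / (A + B + 1)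

theorem raisingExponent_ratio {N : ℕ} (A B : ℕ) {s i j : Fin N} (hij : i < j) :
    (((raisingExponent A B s i - raisingExponent A B s j + 1 : ℕ) : ℚ) *
      ((raisingExponent A B s j + 1 : ℕ) : ℚ)) =
    (if i = s then ratioFactor A B else 1) *
      (((raisingExponent A B s j - raisingExponent A B s i + 1 : ℕ) : ℚ) *
        ((raisingExponent A B s i + 1 : ℕ) : ℚ)) := by
  have h0 : (A + B + 1 : ℚ) ≠ 0 := by positivity
  rcases lt_trichotomy i s with h | rfl | h
  · rw [if_neg h.ne]
    rcases lt_trichotomy j s with h' | rfl | h'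
    · simp [raisingExponent, h, h']
    · simp [raisingExponent, h]
    · simp [raisingExponent, h, h'.ne', not_lt.2 h'.le]
  · simp only [raisingExponent, lt_irrefl, if_true, if_false, not_lt.2 hij.le, hij.ne', ratioFactor]
    rw [Nat.add_sub_cancel_left, Nat.sub_eq_zero_of_le (by lia)]
    push_cast
    field_simp
  · rw [if_neg h.ne']
    simp [raisingExponent, h.ne', not_lt.2 h.le, (h.trans hij).ne', not_lt.2 (h.trans hij).le]

theorem loweringExponent_ratio {N : ℕ} (A B : ℕ) {s i j : Fin N} (hij : i < j) :
    (((loweringExponent A B s i - loweringExponent A B s j + 1 : ℕ) : ℚ) *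
      ((loweringExponent A B s j + 1 : ℕ) : ℚ)) =
    (if j = s then (ratioFactor A B)⁻¹ else 1) *
      (((loweringExponent A B s j - loweringExponent A B s i + 1 : ℕ) : ℚ) *
        ((loweringExponent A B s i + 1 : ℕ) : ℚ)) := by
  have h0 : (A + B + 1 : ℚ) ≠ 0 := by positivity
  rcases lt_trichotomy j s with h | rfl | h
  · simp [loweringExponent, h.ne, h, hij.trans h]
  · simp only [loweringExponent, lt_irrefl, if_true, if_false, hij, ratioFactor]
    rw [Nat.add_sub_cancel_left, Nat.sub_eq_zero_of_le (by lia)]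
    push_cast
    field_simp
  · rw [if_neg h.ne']
    rcases lt_trichotomy i s with h' | rfl | h'
    · simp [loweringExponent, h', h.ne', not_lt.2 h.le]
    · simp [loweringExponent, hij.ne', not_lt.2 hij.le]
    · simp [loweringExponent, h.ne', h'.ne', not_lt.2 h'.le, not_lt.2 h.le]

theorem exists_exponent_table {Γ : Type} [Fintype Γ] [DecidableEq Γ] (A B : Γ → ℕ) (up : Γ → Bool)
    {N E : ℕ} (hE : ∀ γ, A γ + B γ ≤ E) (hNE : N ≤ E) (hN : Fintype.card Γ + 20 ≤ N) :
    ∃ (κ : Type) (_ : Fintype κ) (_ : DecidableEq κ) (ϖ : κ → ℕ) (μ ν : κ → Fin N → ℕ),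
      (∀ c, (ϖ c).Prime) ∧ Function.Injective ϖ ∧ Fintype.card κ ≤ N ^ 2 ∧
      (∀ c, ϖ c ≤ 2 ^ (2 * N ^ 2)) ∧ (∀ p, p.Prime → p ≤ 4 * N → ∃ c, ϖ c = p) ∧
      (∀ c i, μ c i ≤ E) ∧ (∀ c i, ν c i ≤ E) ∧ (∀ c i j, i ≠ j → μ c i = μ c j → N < ϖ c) ∧
      ∀ i j, i < j →
        (∏ c, ((μ c i - μ c j + 1 : ℕ) : ℚ)) * ∏ c, ((ν c j + 1 : ℕ) : ℚ) =
          (∏ γ, if up γ then ratioFactor (A γ) (B γ) else (ratioFactor (A γ) (B γ))⁻¹) *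
            ((∏ c, ((μ c j - μ c i + 1 : ℕ) : ℚ)) * ∏ c, ((ν c i + 1 : ℕ) : ℚ)) := by
  set Sm := {p // p ∈ (Finset.range (4 * N + 1)).filter Nat.Prime}
  have hSmcard : Fintype.card Sm ≤ 4 * N := by
    refine (Fintype.card_coe _).trans_le ?_
    have : (Finset.range (4 * N + 1)).filter Nat.Prime ⊆ (Finset.range (4 * N + 1)).erase 0 := by
      intro p hp
      rw [Finset.mem_filter] at hp
      exact Finset.mem_erase.2 ⟨hp.2.ne_zero, hp.1⟩
    refine (Finset.card_le_card this).trans ?_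
    rw [Finset.card_erase_of_mem (by simp), Finset.card_range, Nat.add_sub_cancel]
  obtain ⟨σ, hinj, hσ⟩ := exists_injOn_prime (Finset.univ : Finset (Sm ⊕ Fin N × Γ))
    (B := 4 * N) (by lia)
  have hσcard : (Finset.univ : Finset (Sm ⊕ Fin N × Γ)).card ≤ N ^ 2 - 4 * N := by
    have h1 : Fintype.card Γ ≤ N - 20 := by lia
    have h2 := Nat.mul_le_mul_left N h1
    rw [Finset.card_univ, Fintype.card_sum, Fintype.card_prod, Fintype.card_fin]
    have h3 : N * (N - 20) + 20 * N = N ^ 2 := by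
      obtain ⟨n, rfl⟩ := Nat.exists_eq_add_of_le (show 20 ≤ N by lia)
      rw [Nat.add_sub_cancel_left]
      ring
    lia
  have hN2 : 4 * N ≤ N ^ 2 := by nlinarith
  set ϖ : Sm ⊕ (Sm ⊕ Fin N × Γ) → ℕ := Sum.elim (fun p => p.1) σ with hϖ
  set corr : Fin N × Γ → Fin N → ℕ := fun c => if up c.2
    then raisingExponent (A c.2) (B c.2) c.1 else loweringExponent (A c.2) (B c.2) c.1 with hcorr
  set μ : Sm ⊕ (Sm ⊕ Fin N × Γ) → Fin N → ℕ :=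
    Sum.elim (fun _ i => i) (Sum.elim (fun _ i => N - i) corr) with hμ
  set ν : Sm ⊕ (Sm ⊕ Fin N × Γ) → Fin N → ℕ :=
    Sum.elim (fun _ _ => 0) (Sum.elim (fun _ _ => 0) corr) with hν
  have hcorrE : ∀ c i, corr c i ≤ E := by
    intro c i
    have := hE c.2
    simp only [hcorr]
    split_ifs
    · unfold raisingExponent
      split_ifs <;> lia
    · unfold loweringExponent
      split_ifs <;> lia
  have hSm_mem : ∀ p : Sm, p.1 < 4 * N + 1 ∧ p.1.Prime := fun p => by
    have := Finset.mem_filter.1 p.2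
    exact ⟨Finset.mem_range.1 this.1, this.2⟩
  refine ⟨Sm ⊕ (Sm ⊕ Fin N × Γ), inferInstance, inferInstance, ϖ, μ, ν,
    ?_, ?_, ?_, ?_, ?_, ?_, ?_, ?_, ?_⟩
  · rintro (p | c)
    · exact (hSm_mem p).2
    · exact (hσ c (Finset.mem_univ _)).1
  · refine Function.Injective.sumElim Subtype.val_injective ?_ ?_
    · exact fun a b h => hinj (by simp) (by simp) h
    · intro p c h
      have := (hσ c (Finset.mem_univ _)).2.1
      have := (hSm_mem p).1
      lia
  · rw [Fintype.card_sum]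
    rw [Finset.card_univ] at hσcard
    lia
  · have h4 : 4 * N ≤ 2 ^ N ^ 2 := (hN2).trans Nat.lt_two_pow_self.le
    have h5 : 2 ^ (2 * N ^ 2) = 2 ^ N ^ 2 * 2 ^ N ^ 2 := by rw [two_mul, pow_add]
    rintro (p | c)
    · have := (hSm_mem p).1
      have := Nat.one_le_two_pow (n := N ^ 2)
      simp only [hϖ, Sum.elim_inl]
      nlinarith
    · refine (hσ c (Finset.mem_univ _)).2.2.trans ?_
      rw [h5]
      refine Nat.mul_le_mul (Nat.pow_le_pow_right (by norm_num) ?_) h4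
      lia
  · intro p hp hpN
    exact ⟨Sum.inl ⟨p, by simp [hp]; lia⟩, rfl⟩
  · rintro (p | p | c) i
    · exact i.2.le.trans hNE
    · exact (Nat.sub_le _ _).trans hNE
    · exact hcorrE c i
  · rintro (p | p | c) i
    · exact Nat.zero_le _
    · exact Nat.zero_le _
    · exact hcorrE c i
  · rintro (p | c) i j hij h
    · exact absurd (Fin.ext h) hij
    · have := (hσ c (Finset.mem_univ _)).2.1
      simp only [hϖ, Sum.elim_inr]
      lia
  · intro i j hij
    have hc : ∀ c : Fin N × Γ, ((corr c i - corr c j + 1 : ℕ) : ℚ) * ((corr c j + 1 : ℕ) : ℚ) =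
        (if up c.2 then (if i = c.1 then ratioFactor (A c.2) (B c.2) else 1)
          else (if j = c.1 then (ratioFactor (A c.2) (B c.2))⁻¹ else 1)) *
        (((corr c j - corr c i + 1 : ℕ) : ℚ) * ((corr c i + 1 : ℕ) : ℚ)) := by
      intro c
      simp only [hcorr]
      split_ifs with h1 h2 h2
      · simpa [h2] using raisingExponent_ratio (A c.2) (B c.2) (s := c.1) hij
      · simpa [h2] using raisingExponent_ratio (A c.2) (B c.2) (s := c.1) hij
      · simpa [h2] using loweringExponent_ratio (A c.2) (B c.2) (s := c.1) hij
      · simpa [h2] using loweringExponent_ratio (A c.2) (B c.2) (s := c.1) hij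
    have hprod : (∏ c : Fin N × Γ,
        (if up c.2 then (if i = c.1 then ratioFactor (A c.2) (B c.2) else 1)
          else (if j = c.1 then (ratioFactor (A c.2) (B c.2))⁻¹ else 1))) =
        ∏ γ, if up γ then ratioFactor (A γ) (B γ) else (ratioFactor (A γ) (B γ))⁻¹ := by
      rw [Fintype.prod_prod_type_right]
      refine Finset.prod_congr rfl fun γ _ => ?_
      split_ifs
      · rw [Finset.prod_ite_eq, if_pos (Finset.mem_univ _)]
      · rw [Finset.prod_ite_eq, if_pos (Finset.mem_univ _)]
    have hcc := Finset.prod_congr (rfl : (Finset.univ : Finset (Fin N × Γ)) = Finset.univ)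
      fun c _ => hc c
    rw [Finset.prod_mul_distrib, Finset.prod_mul_distrib, hprod, Finset.prod_mul_distrib] at hcc
    have e1 : (i : ℕ) - j + 1 = 1 := by lia
    have e2 : N - (j : ℕ) - (N - i) + 1 = 1 := by lia
    have e3 : N - (i : ℕ) - (N - j) + 1 = j - i + 1 := by lia
    simp only [hμ, hν, Fintype.prod_sum_type, Sum.elim_inl, Sum.elim_inr, e1, e2, e3, zero_add,
      Nat.cast_one, Finset.prod_const_one, one_mul]
    linear_combination (∏ p : Sm, ((j - i + 1 : ℕ) : ℚ)) * hcc

theorem exists_not_modEq {n π : ℕ} (hn : n < π) (P : ℕ → ℕ) :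
    ∃ ρ, ∀ i < n, ¬ P i ≡ ρ [MOD π] := by
  have hcard : ((Finset.range n).image fun i => P i % π).card < (Finset.range π).card := by
    refine Finset.card_image_le.trans_lt ?_
    simpa using hn
  obtain ⟨ρ, hρ, hρ'⟩ := Finset.exists_mem_notMem_of_card_lt_card hcard
  refine ⟨ρ, fun i hi h => hρ' (Finset.mem_image.2 ⟨i, Finset.mem_range.2 hi, ?_⟩)⟩
  rw [h, Nat.mod_eq_of_lt (Finset.mem_range.1 hρ)]

theorem exists_modEq_of_rare_coincidences {M N h : ℕ} (hM0 : 0 < M) (hM : M ≤ 2 ^ h) (hh : 1 ≤ h)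
    (hsmall : ∀ p, p.Prime → p ≤ N → p ∣ M) (r : ℕ → ℕ) {n : ℕ} (hn : n ≤ N) :
    ∃ P : ℕ → ℕ, (∀ i < n, P i ≡ r i [MOD M]) ∧ (∀ i j, i < j → j < n → P i < P j) ∧
      (∀ i < n, P i ≤ 2 ^ (h * (N ^ 2 + 3) ^ n)) ∧
      ∀ p, p.Prime → ¬ p ∣ M → ∀ i j i' j', i < j → j < n → i' < j' → j' < n →
        P i ≡ P j [MOD p] → P i' ≡ P j' [MOD p] → i = i' ∧ j = j' := by
  induction n with
  | zero => exact ⟨fun _ => 0, by simp, by simp, by simp, by simp⟩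
  | succ n ih =>
    obtain ⟨P, hPr, hPlt, hPle, hPco⟩ := ih (by lia)
    set g := h * (N ^ 2 + 3) ^ n with hg
    have hg1 : h ≤ g := Nat.le_mul_of_pos_right _ (by positivity)
    set T := (Finset.range n ×ˢ Finset.range n).filter fun e => e.1 < e.2 with hT
    have hTmem : ∀ e ∈ T, e.1 < e.2 ∧ e.2 < n := by
      intro e he
      simp only [hT, Finset.mem_filter, Finset.mem_product, Finset.mem_range] at he
      exact ⟨he.2, he.1.2⟩
    set F := ∏ e ∈ T, (P e.2 - P e.1) with hF
    have hF0 : F ≠ 0 := by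
      refine Finset.prod_ne_zero_iff.2 fun e he => ?_
      have := hPlt e.1 e.2 (hTmem e he).1 (hTmem e he).2
      lia
    have hTcard : T.card ≤ N ^ 2 := by
      refine (Finset.card_filter_le _ _).trans ?_
      rw [Finset.card_product, Finset.card_range, sq]
      exact Nat.mul_le_mul (by lia) (by lia)
    have hFle : F ≤ 2 ^ (g * N ^ 2) := by
      rw [pow_mul]
      refine (Finset.prod_le_pow_card T _ (2 ^ g) fun e he => ?_).trans
        (Nat.pow_le_pow_right Nat.one_le_two_pow hTcard)
      exact (Nat.sub_le _ _).trans (hPle _ (hTmem e he).2)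
    set U := F.primeFactors.filter fun p => ¬ p ∣ M with hU
    have hUp : ∀ p ∈ U, p.Prime ∧ ¬ p ∣ M := fun p hp =>
      ⟨Nat.prime_of_mem_primeFactors (Finset.mem_filter.1 hp).1, (Finset.mem_filter.1 hp).2⟩
    have hUmem : ∀ p, p.Prime → ¬ p ∣ M → ∀ i j, i < j → j < n → P i ≡ P j [MOD p] → p ∈ U := by
      intro p hp hpM i j hij hj h
      rw [hU, Finset.mem_filter, Nat.mem_primeFactors]
      refine ⟨⟨hp, ?_, hF0⟩, hpM⟩
      have hdvd : P j - P i ∣ F := Finset.dvd_prod_of_mem (fun e : ℕ × ℕ => P e.2 - P e.1)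
        (a := (i, j)) (by simp only [hT, Finset.mem_filter, Finset.mem_product, Finset.mem_range]
                          lia)
      exact ((Nat.modEq_iff_dvd' (hPlt i j hij hj).le).1 h).trans hdvd
    have hres : ∀ p, ∃ ρ, p ∈ U → ∀ i < n, ¬ P i ≡ ρ [MOD p] := by
      intro p
      by_cases hp : p ∈ U
      · have : n < p := by
          by_contra hle
          exact (hUp p hp).2 (hsmall p (hUp p hp).1 (by lia))
        obtain ⟨ρ, hρ⟩ := exists_not_modEq this P
        exact ⟨ρ, fun _ => hρ⟩
      · exact ⟨0, fun h => absurd h hp⟩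
    choose ρ hρ using hres
    obtain ⟨y, hy, -⟩ := exists_forall_modEq U id ρ (fun p hp => (hUp p hp).1.ne_zero)
      fun p hp q hq hpq => (Nat.coprime_primes (hUp p hp).1 (hUp q hq).1).2 hpq
    set V := ∏ p ∈ U, p with hV
    have hV0 : 0 < V := Finset.prod_pos fun p hp => (hUp p hp).1.pos
    have hVle : V ≤ 2 ^ (g * N ^ 2) :=
      (Nat.le_of_dvd (Nat.pos_of_ne_zero hF0) ((Finset.prod_dvd_prod_of_subset _ _ _
        (Finset.filter_subset _ _)).trans (Nat.prod_primeFactors_dvd F))).trans hFle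
    have hMV : M.Coprime V := Nat.Coprime.prod_right fun p hp =>
      (((hUp p hp).1.coprime_iff_not_dvd).2 (hUp p hp).2).symm
    set x := Nat.chineseRemainder hMV (r n) y with hx
    have hxlt : (x : ℕ) < M * V := Nat.chineseRemainder_lt_mul hMV _ _ hM0.ne' hV0.ne'
    set z := (x : ℕ) + M * V * (2 ^ g + 1) with hz
    have hzM : z ≡ r n [MOD M] := by
      refine Nat.ModEq.trans ?_ x.2.1
      rw [hz, mul_assoc]
      exact Nat.add_mul_mod_self_left _ _ _
    have hzU : ∀ p ∈ U, ∀ i < n, ¬ P i ≡ z [MOD p] := by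
      intro p hp i hi h
      refine hρ p hp i hi (h.trans ?_)
      refine Nat.ModEq.trans ?_ (hy p hp)
      have hpV : p ∣ V := Finset.dvd_prod_of_mem _ hp
      have h1 : z ≡ x [MOD V] := by
        rw [hz, mul_comm M V, mul_assoc]
        exact Nat.add_mul_mod_self_left _ _ _
      exact (h1.trans x.2.2).of_dvd hpV
    have hz_gt : ∀ i < n, P i < z := by
      intro i hi
      have h1 := hPle i hi
      have h2 : 2 ^ g + 1 ≤ M * V * (2 ^ g + 1) :=
        Nat.le_mul_of_pos_left _ (Nat.mul_pos hM0 hV0)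
      lia
    have hz_le : z ≤ 2 ^ (h * (N ^ 2 + 3) ^ (n + 1)) := by
      have h1 : z ≤ M * V * (2 ^ g + 2) := by
        rw [hz]
        linarith
      have h2 : 2 ^ g + 2 ≤ 2 ^ (g + 1) := by
        have : 2 ^ 1 ≤ 2 ^ g := Nat.pow_le_pow_right (by norm_num) (by lia)
        rw [pow_succ]
        lia
      calc z ≤ 2 ^ h * 2 ^ (g * N ^ 2) * 2 ^ (g + 1) :=
            h1.trans (Nat.mul_le_mul (Nat.mul_le_mul hM hVle) h2)
        _ = 2 ^ (h + g * N ^ 2 + (g + 1)) := by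
            rw [pow_add 2 (h + g * N ^ 2), pow_add 2 h]
        _ ≤ _ := by
            refine Nat.pow_le_pow_right (by norm_num) ?_
            rw [pow_succ (N ^ 2 + 3), ← mul_assoc, ← hg]
            linarith
    have hupd : ∀ i < n, Function.update P n z i = P i := fun i hi =>
      Function.update_of_ne hi.ne _ _
    have hcross : ∀ p, p.Prime → ¬ p ∣ M → ∀ i i' j', i < n → i' < j' → j' < n →
        P i ≡ z [MOD p] → ¬ P i' ≡ P j' [MOD p] := fun p hp hpM i i' j' hi hij' hj' h1 h2 =>
      hzU p (hUmem p hp hpM i' j' hij' hj' h2) i hi h1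
    refine ⟨Function.update P n z, ?_, ?_, ?_, ?_⟩
    · intro i hi
      rcases Nat.lt_succ_iff_lt_or_eq.1 hi with hi | rfl
      · rw [hupd i hi]
        exact hPr i hi
      · rwa [Function.update_self]
    · intro i j hij hj
      rcases Nat.lt_succ_iff_lt_or_eq.1 hj with hj | rfl
      · rw [hupd i (hij.trans hj), hupd j hj]
        exact hPlt i j hij hj
      · rw [hupd i hij, Function.update_self]
        exact hz_gt i hij
    · intro i hi
      rcases Nat.lt_succ_iff_lt_or_eq.1 hi with hi | rfl
      · rw [hupd i hi]
        refine (hPle i hi).trans (Nat.pow_le_pow_right (by norm_num) ?_)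
        exact Nat.mul_le_mul_left _ (Nat.pow_le_pow_right (by positivity) (by lia))
      · rwa [Function.update_self]
    · intro p hp hpM i j i' j' hij hj hij' hj' h1 h2
      rcases Nat.lt_succ_iff_lt_or_eq.1 hj with hj | rfl <;>
        rcases Nat.lt_succ_iff_lt_or_eq.1 hj' with hj' | rfl
      · rw [hupd i (by lia), hupd j hj] at h1
        rw [hupd i' (by lia), hupd j' hj'] at h2
        exact hPco p hp hpM i j i' j' hij hj hij' hj' h1 h2
      · rw [hupd i (by lia), hupd j hj] at h1
        rw [hupd i' hij', Function.update_self] at h2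
        exact absurd h1 (hcross p hp hpM i' i j hij' hij hj h2)
      · rw [hupd i hij, Function.update_self] at h1
        rw [hupd i' (by lia), hupd j' hj'] at h2
        exact absurd h2 (hcross p hp hpM i i' j' hij hij' hj' h1)
      · rw [hupd i hij, Function.update_self] at h1
        rw [hupd i' hij', Function.update_self] at h2
        have h3 := h1.trans h2.symm
        rcases lt_trichotomy i i' with h | h | h
        · exact absurd h3 (hcross p hp hpM i i i' hij h hij' h1)
        · exact ⟨h, rfl⟩
        · exact absurd h3.symm (hcross p hp hpM i i' i hij h hij h1)

theorem pow_dvd_and_not_pow_succ_dvd_of_modEq {p m E u n : ℕ} (hp : p.Prime) (hm : m ≤ E)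
    (hu : ¬ p ∣ u) (h : n ≡ u * p ^ m [MOD p ^ (E + 1)]) :
    p ^ m ∣ n ∧ ¬ p ^ (m + 1) ∣ n := by
  constructor
  · exact ((h.of_dvd (pow_dvd_pow p (by lia : m ≤ E + 1))).dvd_iff dvd_rfl).2 (dvd_mul_left _ _)
  · rw [(h.of_dvd (pow_dvd_pow p (by lia : m + 1 ≤ E + 1))).dvd_iff dvd_rfl, pow_succ, mul_comm u,
      Nat.mul_dvd_mul_iff_left (pow_pos hp.pos m)]
    exact hu

theorem pow_min_dvd_sub_of_modEq {p E m m' u u' n n' : ℕ} (hp : p.Prime) (hm : m ≤ E) (hm' : m' ≤ E)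
    (hu : ¬ p ∣ u) (hu' : ¬ p ∣ u') (hlt : n < n') (h : n ≡ u * p ^ m [MOD p ^ (E + 1)])
    (h' : n' ≡ u' * p ^ m' [MOD p ^ (E + 1)]) (hne : m = m' → ¬ u ≡ u' [MOD p]) :
    p ^ min m m' ∣ n' - n ∧ ¬ p ^ (min m m' + 1) ∣ n' - n := by
  obtain ⟨h1, h2⟩ := pow_dvd_and_not_pow_succ_dvd_of_modEq hp hm hu h
  obtain ⟨h1', h2'⟩ := pow_dvd_and_not_pow_succ_dvd_of_modEq hp hm' hu' h'
  refine ⟨Nat.dvd_sub ((pow_dvd_pow p (min_le_right _ _)).trans h1')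
    ((pow_dvd_pow p (min_le_left _ _)).trans h1), fun hd => ?_⟩
  rcases lt_trichotomy m m' with hlt' | rfl | hlt'
  · rw [min_eq_left hlt'.le] at hd
    exact h2 ((Nat.dvd_sub_iff_right hlt.le ((pow_dvd_pow p hlt').trans h1')).1 hd)
  · rw [min_self] at hd
    have h3 : n ≡ n' [MOD p ^ (m + 1)] := (Nat.modEq_iff_dvd' hlt.le).2 hd
    have hpm := pow_dvd_pow p (by lia : m + 1 ≤ E + 1)
    have h4 := ((h.of_dvd hpm).symm.trans h3).trans (h'.of_dvd hpm)
    rw [pow_succ, mul_comm u, mul_comm u'] at h4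
    exact hne rfl (Nat.ModEq.mul_left_cancel' (pow_pos hp.pos m).ne' h4)
  · rw [min_eq_right hlt'.le] at hd
    refine h2' ?_
    have := Nat.dvd_add hd ((pow_dvd_pow p hlt').trans h1)
    rwa [Nat.sub_add_cancel hlt.le] at this

theorem exists_eq_prod_pow_mul {κ : Type*} [Fintype κ] {ϖ m : κ → ℕ} {n : ℕ}
    (hϖ : ∀ c, (ϖ c).Prime) (hinj : Function.Injective ϖ)
    (h : ∀ c, ϖ c ^ m c ∣ n ∧ ¬ ϖ c ^ (m c + 1) ∣ n) :
    ∃ v, n = (∏ c, ϖ c ^ m c) * v ∧ ∀ c, ¬ ϖ c ∣ v := by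
  have hdvd : ∏ c, ϖ c ^ m c ∣ n := by
    refine Finset.prod_dvd_of_isRelPrime (fun a _ b _ hab => ?_) fun c _ => (h c).1
    rw [Function.onFun, ← Nat.coprime_iff_isRelPrime]
    exact Nat.Coprime.pow _ _ ((Nat.coprime_primes (hϖ a) (hϖ b)).2 fun e => hab (hinj e))
  obtain ⟨v, rfl⟩ := hdvd
  refine ⟨v, rfl, fun c hc => (h c).2 ?_⟩
  rw [pow_succ]
  exact mul_dvd_mul (Finset.dvd_prod_of_mem (fun c => ϖ c ^ m c) (Finset.mem_univ c)) hc

theorem exists_shifts {κ : Type*} [Fintype κ] [DecidableEq κ] {N E h : ℕ} {ϖ : κ → ℕ}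
    {μ : κ → Fin N → ℕ} (hϖ : ∀ c, (ϖ c).Prime) (hinj : Function.Injective ϖ)
    (hμ : ∀ c i, μ c i ≤ E) (hsep : ∀ c i j, i ≠ j → μ c i = μ c j → N < ϖ c)
    (hsmall : ∀ p, p.Prime → p ≤ N → ∃ c, ϖ c = p)
    (hM : ∏ c, ϖ c ^ (E + 1) ≤ 2 ^ h) (hh : 1 ≤ h) :
    ∃ P : Fin N → ℕ, StrictMono P ∧ (∀ i, P i ≤ 2 ^ (h * (N ^ 2 + 3) ^ N)) ∧
      (∀ i, ∃ v, P i = (∏ c, ϖ c ^ μ c i) * v ∧ ∀ c, ¬ ϖ c ∣ v) ∧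
      (∀ i j, i < j → ∃ D, P j - P i = (∏ c, ϖ c ^ min (μ c i) (μ c j)) * D ∧ ∀ c, ¬ ϖ c ∣ D) ∧
      ∀ p, p.Prime → (∀ c, ϖ c ≠ p) → ∀ i j i' j', i < j → i' < j' →
        P i ≡ P j [MOD p] → P i' ≡ P j' [MOD p] → i = i' ∧ j = j' := by
  set u : κ → Fin N → ℕ := fun c i => if N < ϖ c then i + 1 else 1 with hu
  have hup : ∀ c i, ¬ ϖ c ∣ u c i := by
    intro c i hd
    have h1 := (hϖ c).two_le
    have h2 := i.2
    have h3 := Nat.le_of_dvd (by simp only [hu]; split_ifs <;> lia) hd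
    simp only [hu] at h3
    split_ifs at h3 <;> lia
  have hune : ∀ c i j, i ≠ j → μ c i = μ c j → ¬ u c i ≡ u c j [MOD ϖ c] := by
    intro c i j hij hμij h
    have hN := hsep c i j hij hμij
    simp only [hu, if_pos hN] at h
    have := h.eq_of_lt_of_lt (by lia) (by lia)
    exact hij (Fin.ext (by lia))
  set M := ∏ c, ϖ c ^ (E + 1) with hMdef
  have hdvdM : ∀ c, ϖ c ^ (E + 1) ∣ M := fun c =>
    Finset.dvd_prod_of_mem (fun c => ϖ c ^ (E + 1)) (Finset.mem_univ c)
  have hM0 : 0 < M := Finset.prod_pos fun c _ => pow_pos (hϖ c).pos _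
  have hres : ∀ i : Fin N, ∃ r, ∀ c, r ≡ u c i * ϖ c ^ μ c i [MOD ϖ c ^ (E + 1)] := by
    intro i
    obtain ⟨r, hr, -⟩ := exists_forall_modEq Finset.univ (fun c => ϖ c ^ (E + 1))
      (fun c => u c i * ϖ c ^ μ c i) (fun c _ => (pow_pos (hϖ c).pos _).ne')
      fun a _ b _ hab => Nat.Coprime.pow _ _
        ((Nat.coprime_primes (hϖ a) (hϖ b)).2 fun e => hab (hinj e))
    exact ⟨r, fun c => hr c (Finset.mem_univ c)⟩
  choose r hr using hres
  obtain ⟨P, hPr, hPlt, hPle, hPco⟩ := exists_modEq_of_rare_coincidences hM0 hM hh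
    (N := N) (n := N) (fun p hp hpN => by
      obtain ⟨c, rfl⟩ := hsmall p hp hpN
      exact (dvd_pow_self _ (Nat.succ_ne_zero E)).trans (hdvdM c))
    (fun i => if hi : i < N then r ⟨i, hi⟩ else 0) le_rfl
  have hPc : ∀ (i : Fin N) c, P i ≡ u c i * ϖ c ^ μ c i [MOD ϖ c ^ (E + 1)] := by
    intro i c
    have h1 := hPr i i.2
    rw [dif_pos i.2] at h1
    exact (h1.of_dvd (hdvdM c)).trans (hr i c)
  refine ⟨fun i => P i, fun i j hij => hPlt i j hij j.2, fun i => hPle i i.2, ?_, ?_, ?_⟩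
  · exact fun i => exists_eq_prod_pow_mul hϖ hinj fun c =>
      pow_dvd_and_not_pow_succ_dvd_of_modEq (hϖ c) (hμ c i) (hup c i) (hPc i c)
  · exact fun i j hij => exists_eq_prod_pow_mul hϖ hinj fun c =>
      pow_min_dvd_sub_of_modEq (hϖ c) (hμ c i) (hμ c j) (hup c i) (hup c j)
        (hPlt i j hij j.2) (hPc i c) (hPc j c) (hune c i j hij.ne)
  · intro p hp hpc i j i' j' hij hij' h1 h2
    have hpM : ¬ p ∣ M := by
      intro hd
      obtain ⟨c, -, hc⟩ := (Prime.dvd_finsetProd_iff hp.prime _).1 hd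
      exact hpc c ((Nat.prime_dvd_prime_iff_eq hp (hϖ c)).1 (hp.dvd_of_dvd_pow hc)).symm
    obtain ⟨e1, e2⟩ := hPco p hp hpM i j i' j' hij j.2 hij' j'.2 h1 h2
    exact ⟨Fin.ext e1, Fin.ext e2⟩

theorem exists_modEq_forall_factor {ι ε : Type*} [Fintype ε] [DecidableEq ε] {W a : ε → ℕ}
    {c : ι → ε → ℕ} {P : ι → ℕ} (hW0 : ∀ e, W e ≠ 0) (hW : Pairwise (Function.onFun Nat.Coprime W))
    (hc : ∀ i e, c i e ∣ W e) (hcW : ∀ i e p, p.Prime → p ∣ W e → p * c i e ∣ W e)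
    (hw : ∀ i e, ∃ w, a e ≡ P i + c i e * w [MOD W e] ∧ w.Coprime (W e)) :
    ∃ m₀ < ∏ e, W e, ∀ m, m ≡ m₀ [MOD ∏ e, W e] → ∀ i, P i ≤ m →
      ∃ b, m = P i + (∏ e, c i e) * b ∧ b.Coprime (∏ e, W e) := by
  obtain ⟨m₀, hm₀, hlt⟩ := exists_forall_modEq Finset.univ W a (fun e _ => hW0 e)
    fun e _ f _ hef => hW hef
  refine ⟨m₀, hlt, fun m hm i hi => ?_⟩
  obtain ⟨n, rfl⟩ := Nat.exists_eq_add_of_le hi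
  choose w hw hwW using hw i
  have hn : ∀ e, n ≡ c i e * w e [MOD W e] := fun e =>
    Nat.ModEq.add_left_cancel' (P i) (((hm.of_dvd (Finset.dvd_prod_of_mem W
      (Finset.mem_univ e))).trans (hm₀ e (Finset.mem_univ e))).trans (hw e))
  have hdvd : ∏ e, c i e ∣ n := by
    refine Finset.prod_dvd_of_isRelPrime (fun e _ f _ hef => ?_) fun e _ => ?_
    · rw [Function.onFun, ← Nat.coprime_iff_isRelPrime]
      exact Nat.Coprime.coprime_dvd_left (hc i e) (Nat.Coprime.coprime_dvd_right (hc i f) (hW hef))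
    · exact (((hn e).of_dvd (hc i e)).dvd_iff dvd_rfl).2 (dvd_mul_right _ _)
  obtain ⟨b, rfl⟩ := hdvd
  refine ⟨b, rfl, Nat.Coprime.prod_right fun e _ => Nat.coprime_of_dvd fun p hp hpb hpe => ?_⟩
  have h1 : p * c i e ∣ (∏ e, c i e) * b := by
    rw [mul_comm]
    exact mul_dvd_mul (Finset.dvd_prod_of_mem (c i) (Finset.mem_univ e)) hpb
  have h2 := (((hn e).of_dvd (hcW i e p hp hpe)).dvd_iff dvd_rfl).1 h1
  have h3 : c i e ≠ 0 := fun h => hW0 e (Nat.eq_zero_of_zero_dvd (h ▸ hc i e))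
  rw [mul_comm, Nat.mul_dvd_mul_iff_left (Nat.pos_of_ne_zero h3)] at h2
  exact hp.one_lt.ne' (Nat.dvd_one.1 ((hwW e) ▸ Nat.dvd_gcd h2 hpe))

theorem exists_cofactor {ε : Type*} [Fintype ε] [DecidableEq ε] {W c : ε → ℕ}
    (hW0 : ∀ e, W e ≠ 0) (hc : ∀ e, c e ∣ W e) (hcW : ∀ e p, p.Prime → p ∣ W e → p * c e ∣ W e) :
    ∃ q, ∏ e, W e = (∏ e, c e) * q ∧ ∀ p, p.Prime → p ∣ ∏ e, W e → p ∣ q := by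
  choose q hq using hc
  refine ⟨∏ e, q e, ?_, fun p hp hpW => ?_⟩
  · rw [← Finset.prod_mul_distrib]
    exact Finset.prod_congr rfl fun e _ => hq e
  · obtain ⟨e, -, he⟩ := (Prime.dvd_finsetProd_iff hp.prime _).1 hpW
    have h1 := hcW e p hp he
    have h2 : c e ≠ 0 := fun h => hW0 e (by rw [hq e, h, zero_mul])
    rw [hq e, mul_comm, Nat.mul_dvd_mul_iff_left (Nat.pos_of_ne_zero h2)] at h1
    exact h1.trans (Finset.dvd_prod_of_mem q (Finset.mem_univ e))

theorem exists_modEq_add_coprime {a P W : ℕ} (hW : W ≠ 0)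
    (h : ∀ p, p.Prime → p ∣ W → ¬ a ≡ P [MOD p]) :
    ∃ w, a ≡ P + w [MOD W] ∧ w.Coprime W := by
  obtain ⟨V, rfl⟩ := Nat.exists_eq_succ_of_ne_zero hW
  have h1 : a ≡ P + (a + V * P) [MOD V + 1] := by
    have : P + (a + V * P) = a + (V + 1) * P := by ring
    rw [this]
    exact (Nat.add_mul_mod_self_left _ _ _).symm
  refine ⟨a + V * P, h1, Nat.coprime_of_dvd fun p hp hpw hpW => h p hp hpW ?_⟩
  exact (h1.of_dvd hpW).trans ((Nat.modEq_zero_iff_dvd.2 hpw).add_left P)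

theorem exists_modEq_of_eq_mul {P C v M : ℕ} (hM : M ≠ 0) (hP : P = C * v) (hv : v.Coprime M) :
    ∃ w, 0 ≡ P + C * w [MOD M] ∧ w.Coprime M := by
  obtain ⟨V, rfl⟩ := Nat.exists_eq_succ_of_ne_zero hM
  refine ⟨V * v, ?_, Nat.Coprime.mul_left (by simp) hv⟩
  have : P + C * (V * v) = (V + 1) * P := by
    rw [hP]
    ring
  rw [this]
  exact (Nat.modEq_zero_iff_dvd.2 (dvd_mul_right _ _)).symm

/-- The vertex `i` is an endpoint of the pair `e`. -/
abbrev IsEndpoint {N : ℕ} (i : Fin N) (e : Fin N × Fin N) : Prop := e.1 = i ∨ e.2 = i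

theorem exists_common_linear_forms {N M : ℕ} {C P s : Fin N → ℕ} {D : Fin N × Fin N → ℕ}
    (hP : StrictMono P) (hM0 : M ≠ 0) (hCM : ∀ i, C i ∣ M)
    (hCM' : ∀ i p, p.Prime → p ∣ M → p * C i ∣ M) (h2 : 2 ∣ M)
    (hv : ∀ i, ∃ v, P i = C i * v ∧ v.Coprime M)
    (hD0 : ∀ e, D e ≠ 0) (hDM : ∀ e, M.Coprime (D e))
    (hDD : Pairwise (Function.onFun Nat.Coprime D)) (hD1 : ∀ e, ¬ e.1 < e.2 → D e = 1)
    (hG : ∀ i j, i < j → ∃ G, P j - P i = G * D (i, j) ∧ G.Coprime (D (i, j)))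
    (hcol : ∀ e p, p.Prime → p ∣ D e → ∀ i j, i ≠ j → P i ≡ P j [MOD p] →
      IsEndpoint i e ∧ IsEndpoint j e)
    (hs0 : ∀ i, s i ≠ 0) (hss : Pairwise (Function.onFun Nat.Coprime s))
    (hsM : ∀ i, M.Coprime (s i)) (hsD : ∀ e i, (D e).Coprime (s i))
    (hsP : ∀ i p, p.Prime → p ∣ s i → ∀ k, P k < p) :
    ∃ Q m₀ : ℕ, Q = M * ((∏ e, D e ^ 2) * ∏ i, s i ^ 2) ∧ m₀ < Q ∧ ∀ i,
      (∀ m, m ≡ m₀ [MOD Q] → P i ≤ m → ∃ b,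
        m = P i + C i * ((∏ e, if IsEndpoint i e then D e else 1) * s i) * b ∧ b.Coprime Q) ∧
      ∃ q, Q = C i * ((∏ e, if IsEndpoint i e then D e else 1) * s i) * q ∧
        ∀ p, p.Prime → p ∣ Q → p ∣ q := by
  set W : Unit ⊕ (Fin N × Fin N) ⊕ Fin N → ℕ :=
    Sum.elim (fun _ => M) (Sum.elim (fun e => D e ^ 2) fun i => s i ^ 2) with hWdef
  set c : Fin N → Unit ⊕ (Fin N × Fin N) ⊕ Fin N → ℕ := fun i =>
    Sum.elim (fun _ => C i) (Sum.elim (fun e => if IsEndpoint i e then D e else 1)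
      fun k => if k = i then s i else 1) with hcdef
  set a : Unit ⊕ (Fin N × Fin N) ⊕ Fin N → ℕ :=
    Sum.elim (fun _ => 0) (Sum.elim (fun e => 2 * P e.2 - P e.1) fun i => P i + s i) with hadef
  have hWprod : ∏ e, W e = M * ((∏ e, D e ^ 2) * ∏ i, s i ^ 2) := by
    simp [hWdef, Fintype.prod_sum_type]
  have hcprod : ∀ i, ∏ e, c i e =
      C i * ((∏ e, if IsEndpoint i e then D e else 1) * s i) := by
    intro i
    simp [hcdef, Fintype.prod_sum_type]
  have hW0 : ∀ e, W e ≠ 0 := by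
    rintro (_ | e | i)
    · exact hM0
    · exact pow_ne_zero _ (hD0 e)
    · exact pow_ne_zero _ (hs0 i)
  have hWW : Pairwise (Function.onFun Nat.Coprime W) := by
    rintro (_ | e | i) (_ | f | j) hef
    · exact absurd rfl hef
    · exact (hDM f).pow_right 2
    · exact (hsM j).pow_right 2
    · exact ((hDM e).pow_right 2).symm
    · exact (hDD fun h => hef (by rw [h])).pow 2 2
    · exact (hsD e j).pow 2 2
    · exact ((hsM i).pow_right 2).symm
    · exact ((hsD f i).pow 2 2).symm
    · exact (hss fun h => hef (by rw [h])).pow 2 2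
  have hcW : ∀ i e, c i e ∣ W e := by
    rintro i (_ | e | k)
    · exact hCM i
    · simp only [hcdef, hWdef, Sum.elim_inl, Sum.elim_inr]
      split_ifs
      · exact dvd_pow_self _ two_ne_zero
      · exact one_dvd _
    · simp only [hcdef, hWdef, Sum.elim_inr]
      split_ifs with h
      · rw [h]
        exact dvd_pow_self _ two_ne_zero
      · exact one_dvd _
  have hcW' : ∀ i e p, p.Prime → p ∣ W e → p * c i e ∣ W e := by
    rintro i (_ | e | k) p hp hpW
    · exact hCM' i p hp hpW
    · simp only [hcdef, hWdef, Sum.elim_inl, Sum.elim_inr] at hpW ⊢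
      split_ifs
      · rw [sq]
        exact mul_dvd_mul_right (hp.dvd_of_dvd_pow hpW) _
      · rwa [mul_one]
    · simp only [hcdef, hWdef, Sum.elim_inr] at hpW ⊢
      split_ifs with h
      · rw [← h, sq]
        exact mul_dvd_mul_right (hp.dvd_of_dvd_pow hpW) _
      · rwa [mul_one]
  have hw : ∀ i e, ∃ w, a e ≡ P i + c i e * w [MOD W e] ∧ w.Coprime (W e) := by
    rintro i (_ | e | k)
    · obtain ⟨v, hPv, hvM⟩ := hv i
      exact exists_modEq_of_eq_mul hM0 hPv hvM
    · simp only [hcdef, hWdef, hadef, Sum.elim_inl, Sum.elim_inr]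
      by_cases he : e.1 < e.2
      · obtain ⟨G, hGe, hGD⟩ := hG e.1 e.2 he
        have hlt := hP he
        have hodd : Nat.Coprime 2 (D e) := Nat.Coprime.coprime_dvd_left h2 (hDM e)
        have ha : 2 * P e.2 - P e.1 = P e.2 + D e * G := by
          rw [mul_comm (D e), ← hGe]
          lia
        have ha' : 2 * P e.2 - P e.1 = P e.1 + D e * (2 * G) := by
          have : D e * (2 * G) = 2 * (P e.2 - P e.1) := by
            rw [hGe]
            ring
          rw [this]
          lia
        by_cases h1 : e.1 = i
        · rw [if_pos (Or.inl h1), ← h1, ha']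
          exact ⟨2 * G, rfl, (hodd.mul_left hGD).pow_right 2⟩
        by_cases h3 : e.2 = i
        · rw [if_pos (Or.inr h3), ← h3, ha]
          exact ⟨G, rfl, hGD.pow_right 2⟩
        have hend : ¬ IsEndpoint i e := fun h => h.elim h1 h3
        simp only [if_neg hend, one_mul]
        refine exists_modEq_add_coprime (pow_ne_zero _ (hD0 e)) fun p hp hpD h => ?_
        have hpD' := hp.dvd_of_dvd_pow hpD
        refine hend (hcol e p hp hpD' i e.2 (Ne.symm h3) ?_).1
        rw [ha] at h
        refine h.symm.trans ?_
        simpa using (Nat.modEq_zero_iff_dvd.2 (hpD'.mul_right G)).add_left (P e.2)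
      · have := hD1 e he
        simp only [this, one_pow]
        exact ⟨0, Nat.modEq_one, Nat.coprime_one_right _⟩
    · simp only [hcdef, hWdef, hadef, Sum.elim_inr]
      split_ifs with h
      · exact ⟨1, by rw [h, mul_one], Nat.coprime_one_left _⟩
      · simp only [one_mul]
        refine exists_modEq_add_coprime (pow_ne_zero _ (hs0 k)) fun p hp hps h' => ?_
        have hps' := hp.dvd_of_dvd_pow hps
        have h3 : P k + s k ≡ P k [MOD p] := by
          simpa using (Nat.modEq_zero_iff_dvd.2 hps').add_left (P k)
        exact h (hP.injective ((h3.symm.trans h').eq_of_lt_of_lt (hsP k p hp hps' k)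
          (hsP k p hp hps' i)))
  obtain ⟨m₀, hlt, hm₀⟩ := exists_modEq_forall_factor hW0 hWW hcW hcW' hw
  refine ⟨∏ e, W e, m₀, hWprod, hlt, fun i => ⟨fun m hm hi => ?_, ?_⟩⟩
  · rw [← hcprod i]
    exact hm₀ m hm i hi
  · rw [← hcprod i]
    exact exists_cofactor hW0 (hcW i) (hcW' i)

theorem exists_balancing_factors {N h B : ℕ} (X : Fin N → ℕ) (hX0 : ∀ i, X i ≠ 0)
    (hX : ∀ i, X i ≤ 2 ^ h) (hB : 1 ≤ B) :
    ∃ s : Fin N → ℕ, (∀ i, s i ≠ 0) ∧ Pairwise (Function.onFun Nat.Coprime s) ∧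
      (∀ i p, p.Prime → p ∣ s i → B < p) ∧ (∀ i, s i ≤ ((2 ^ (N ^ 2 * h) * B) ^ h) ^ N) ∧
      ∀ i, d (s i) * d (X i) = ∏ k, d (X k) := by
  obtain ⟨Y, hYd, hYY, hYp, hYle⟩ := exists_coprime_copies
    (fun e : Fin N × Fin N => X e.2) (fun e => hX0 e.2) (fun e => hX e.2) hB
  rw [Fintype.card_prod, Fintype.card_fin, ← sq] at hYle
  have hY0 : ∀ e, Y e ≠ 0 := by
    intro e h0
    have h1 := hYd e
    rw [h0] at h1
    exact hX0 e.2 (by simpa [d] using h1.symm)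
  refine ⟨fun i => ∏ k ∈ Finset.univ.erase i, Y (i, k), ?_, ?_, ?_, ?_, ?_⟩
  · exact fun i => Finset.prod_ne_zero_iff.2 fun k _ => hY0 _
  · intro i j hij
    exact Nat.Coprime.prod_left fun k _ => Nat.Coprime.prod_right fun k' _ =>
      hYY fun h => hij (Prod.mk.inj h).1
  · intro i p hp hpi
    obtain ⟨k, -, hk⟩ := (Prime.dvd_finsetProd_iff hp.prime _).1 hpi
    exact hYp _ p hp hk
  · intro i
    refine (Finset.prod_le_pow_card _ _ _ fun k _ => hYle (i, k)).trans ?_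
    refine Nat.pow_le_pow_right (Nat.pow_pos (Nat.mul_pos (by positivity) hB)) ?_
    exact (Finset.card_le_univ _).trans (by simp)
  · intro i
    rw [d_prod _ (fun k => Y (i, k)) fun k _ k' _ hkk' => hYY fun h => hkk' (Prod.mk.inj h).2]
    simp only [hYd]
    exact Finset.prod_erase_mul _ _ (Finset.mem_univ i)

theorem card_divisors_ratio {a a' h h' T T' Ψ Δ : ℕ} {t : ℚ} (hh : h ≠ 0) (hh' : h' ≠ 0)
    (hΔ : Δ ≠ 0) (ha : a * Δ * h = T * Ψ) (ha' : a' * Δ * h' = T' * Ψ)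
    (hT : (T : ℚ) * h' = t * (T' * h)) : (a : ℚ) = t * a' := by
  have h1 : (a : ℚ) * Δ * h = T * Ψ := by exact_mod_cast ha
  have h2 : (a' : ℚ) * Δ * h' = T' * Ψ := by exact_mod_cast ha'
  have h3 : (Δ : ℚ) * h * h' ≠ 0 := by positivity
  refine mul_right_cancel₀ h3 ?_
  linear_combination (h' : ℚ) * h1 + (Ψ : ℚ) * hT - t * h * h2

theorem exists_linear_form_system {κ : Type*} [Fintype κ] [DecidableEq κ] {N E h : ℕ} {ϖ : κ → ℕ}
    {μ ν : κ → Fin N → ℕ} {t : ℚ} (hϖ : ∀ c, (ϖ c).Prime) (hinj : Function.Injective ϖ)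
    (hμ : ∀ c i, μ c i ≤ E) (hν : ∀ c i, ν c i ≤ E)
    (hsep : ∀ c i j, i ≠ j → μ c i = μ c j → N < ϖ c)
    (hsmall : ∀ p, p.Prime → p ≤ 4 * N → ∃ c, ϖ c = p)
    (hM : ∏ c, ϖ c ^ (E + 1) ≤ 2 ^ h) (hh : 1 ≤ h) (hN : 1 ≤ N)
    (ht : ∀ i j, i < j →
      (∏ c, ((μ c i - μ c j + 1 : ℕ) : ℚ)) * ∏ c, ((ν c j + 1 : ℕ) : ℚ) =
        t * ((∏ c, ((μ c j - μ c i + 1 : ℕ) : ℚ)) * ∏ c, ((ν c i + 1 : ℕ) : ℚ))) :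
    ∃ (Q m₀ : ℕ) (P A : Fin N → ℕ), StrictMono P ∧ m₀ < Q ∧
      Q ≤ 2 ^ (h * (N ^ 2 + 3) ^ N) ^ 15 ∧ (∀ i, P i ≤ 2 ^ (h * (N ^ 2 + 3) ^ N)) ∧
      (∀ p, p.Prime → p ≤ 4 * N → p ∣ Q) ∧
      (∀ i, (∀ m, m ≡ m₀ [MOD Q] → P i ≤ m → ∃ b, m = P i + A i * b ∧ b.Coprime Q) ∧
        ∃ q, Q = A i * q ∧ ∀ p, p.Prime → p ∣ Q → p ∣ q) ∧
      ∀ i j, i < j → ∃ a a', A i = (P j - P i) * a ∧ A j = (P j - P i) * a' ∧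
        (d a : ℚ) = t * d a' := by
  obtain ⟨P, hP, hPle, hv, hPD, hcol⟩ := exists_shifts hϖ hinj hμ hsep
    (fun p hp hpN => hsmall p hp (by lia)) hM hh
  set H := h * (N ^ 2 + 3) ^ N with hH
  have hhH : h ≤ H := Nat.le_mul_of_pos_right _ (by positivity)
  have hNH : N ≤ H := by
    have h1 : N < 2 ^ N := Nat.lt_two_pow_self
    have h2 : 2 ^ N ≤ (N ^ 2 + 3) ^ N := Nat.pow_le_pow_left (by lia) _
    have h3 : (N ^ 2 + 3) ^ N ≤ H := Nat.le_mul_of_pos_left _ hh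
    lia
  have hH2 : 2 ≤ H := by
    have h2 : (N ^ 2 + 3) ^ 1 ≤ (N ^ 2 + 3) ^ N := Nat.pow_le_pow_right (by lia) hN
    have h3 : (N ^ 2 + 3) ^ N ≤ H := Nat.le_mul_of_pos_left _ hh
    lia
  set M := ∏ c, ϖ c ^ (E + 1) with hMdef
  have hM0 : M ≠ 0 := Finset.prod_ne_zero_iff.2 fun c _ => pow_ne_zero _ (hϖ c).ne_zero
  have hMle : M ≤ 2 ^ H := hM.trans (Nat.pow_le_pow_right (by norm_num) hhH)
  have hMp : ∀ p, p.Prime → p ∣ M → ∃ c, ϖ c = p := by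
    intro p hp hpM
    obtain ⟨c, -, hc⟩ := (Prime.dvd_finsetProd_iff hp.prime _).1 hpM
    exact ⟨c, ((Nat.prime_dvd_prime_iff_eq hp (hϖ c)).1 (hp.dvd_of_dvd_pow hc)).symm⟩
  have hpM : ∀ c, ϖ c ∣ M := fun c => (dvd_pow_self _ (Nat.succ_ne_zero E)).trans
    (Finset.dvd_prod_of_mem (fun c => ϖ c ^ (E + 1)) (Finset.mem_univ c))
  have hMco : ∀ n, (∀ c, ¬ ϖ c ∣ n) → M.Coprime n := fun n hn =>
    Nat.coprime_of_dvd fun p hp hpM hpn => by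
      obtain ⟨c, rfl⟩ := hMp p hp hpM
      exact hn c hpn
  have hprodM : ∀ e : κ → ℕ, (∀ c, e c ≤ E) → ∏ c, ϖ c ^ e c ∣ M := fun e he =>
    Finset.prod_dvd_prod_of_dvd _ _ fun c _ => pow_dvd_pow _ ((he c).trans (Nat.le_succ E))
  -- the differences, freed of the primes dividing `M`
  have hD : ∀ e : Fin N × Fin N, ∃ D, (∀ c, ¬ ϖ c ∣ D) ∧ (¬ e.1 < e.2 → D = 1) ∧
      (e.1 < e.2 → P e.2 - P e.1 = (∏ c, ϖ c ^ min (μ c e.1) (μ c e.2)) * D) := by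
    intro e
    by_cases he : e.1 < e.2
    · obtain ⟨D, h1, h2⟩ := hPD e.1 e.2 he
      exact ⟨D, h2, fun h => absurd he h, fun _ => h1⟩
    · exact ⟨1, fun c hc => (hϖ c).one_lt.ne' (Nat.dvd_one.1 hc), fun _ => rfl,
        fun h => absurd h he⟩
  choose D hDϖ hD1 hDeq using hD
  have hDp : ∀ e p, p.Prime → p ∣ D e →
      e.1 < e.2 ∧ P e.1 ≡ P e.2 [MOD p] ∧ ∀ c, ϖ c ≠ p := by
    intro e p hp hpe
    have he : e.1 < e.2 := by
      by_contra h
      rw [hD1 e h] at hpe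
      exact hp.one_lt.ne' (Nat.dvd_one.1 hpe)
    refine ⟨he, (Nat.modEq_iff_dvd' (hP he).le).2 ?_, ?_⟩
    · rw [hDeq e he]
      exact hpe.mul_left _
    · rintro c rfl
      exact hDϖ e c hpe
  have hD0 : ∀ e, D e ≠ 0 := by
    intro e h0
    by_cases he : e.1 < e.2
    · have h1 := hDeq e he
      have h2 := hP he
      rw [h0, mul_zero] at h1
      lia
    · rw [hD1 e he] at h0
      exact one_ne_zero h0
  have hDle : ∀ e, D e ≤ 2 ^ H := by
    intro e
    by_cases he : e.1 < e.2
    · refine le_trans (Nat.le_of_dvd ?_ (Dvd.intro_left _ (hDeq e he).symm))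
        ((Nat.sub_le _ _).trans (hPle e.2))
      exact Nat.sub_pos_of_lt (hP he)
    · rw [hD1 e he]
      exact Nat.one_le_two_pow
  have hDcol : ∀ e p, p.Prime → p ∣ D e → ∀ i j, i < j → P i ≡ P j [MOD p] → e = (i, j) := by
    intro e p hp hpe i j hij hmod
    obtain ⟨he, hemod, hc⟩ := hDp e p hp hpe
    obtain ⟨h1, h2⟩ := hcol p hp hc e.1 e.2 i j he hij hemod hmod
    exact Prod.ext h1 h2
  have hDD : Pairwise (Function.onFun Nat.Coprime D) := by
    intro e f hef
    refine Nat.coprime_of_dvd fun p hp hpe hpf => hef ?_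
    obtain ⟨hf, hfmod, -⟩ := hDp f p hp hpf
    exact hDcol e p hp hpe f.1 f.2 hf hfmod
  -- the auxiliary factors
  set Z : Fin N → ℕ := fun k => ∏ e, if IsEndpoint k e then D e else 1 with hZ
  have hZD : ∀ k, Z k = ∏ e ∈ Finset.univ.filter (IsEndpoint k), D e := fun k =>
    (Finset.prod_filter _ _).symm
  have hZle : ∀ k, Z k ≤ 2 ^ (H * N ^ 2) := by
    intro k
    rw [hZD, pow_mul]
    refine (Finset.prod_le_pow_card _ _ _ fun e _ => hDle e).trans
      (Nat.pow_le_pow_right Nat.one_le_two_pow ?_)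
    refine (Finset.card_le_univ _).trans ?_
    rw [Fintype.card_prod, Fintype.card_fin, sq]
  have hZ0 : ∀ k, Z k ≠ 0 := fun k => by
    rw [hZD]
    exact Finset.prod_ne_zero_iff.2 fun e _ => hD0 e
  have hMZ : ∀ k, M.Coprime (Z k) := fun k => by
    rw [hZD]
    exact Nat.Coprime.prod_right fun e _ => hMco _ (hDϖ e)
  obtain ⟨s, hs0, hss, hsp, hsle, hsd⟩ := exists_balancing_factors (h := H ^ 4) (B := 2 ^ H)
    (fun k => (∏ c, ϖ c ^ ν c k) * Z k)
    (fun k => mul_ne_zero (Finset.prod_ne_zero_iff.2 fun c _ => pow_ne_zero _ (hϖ c).ne_zero)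
      (hZ0 k)) (fun k => by
        have h1 := (Nat.le_of_dvd (Nat.pos_of_ne_zero hM0)
          (hprodM (fun c => ν c k) fun c => hν c k)).trans hMle
        refine (Nat.mul_le_mul h1 (hZle k)).trans ?_
        rw [← pow_add]
        refine Nat.pow_le_pow_right (by norm_num) ?_
        have h2 : H * N ^ 2 ≤ H * H ^ 2 := Nat.mul_le_mul_left _ (Nat.pow_le_pow_left hNH 2)
        have h3 : 2 * H ^ 3 ≤ H * H ^ 3 := Nat.mul_le_mul_right _ hH2
        have h4 : H ^ 1 ≤ H ^ 3 := Nat.pow_le_pow_right (by lia) (by norm_num)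
        have h5 : H * H ^ 2 = H ^ 3 := by ring
        have h6 : H * H ^ 3 = H ^ 4 := by ring
        lia) Nat.one_le_two_pow
  have hsM : ∀ i, M.Coprime (s i) := fun i => Nat.coprime_of_dvd fun p hp hpM' hps => by
    have h1 := hsp i p hp hps
    have h2 := Nat.le_of_dvd (Nat.pos_of_ne_zero hM0) hpM'
    lia
  have hsD : ∀ e i, (D e).Coprime (s i) := fun e i => Nat.coprime_of_dvd fun p hp hpD hps => by
    have h1 := hsp i p hp hps
    have h2 := (Nat.le_of_dvd (Nat.pos_of_ne_zero (hD0 e)) hpD).trans (hDle e)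
    lia
  obtain ⟨Q, m₀, hQ, hm₀, hmain⟩ := exists_common_linear_forms (C := fun i => ∏ c, ϖ c ^ μ c i)
    hP hM0 (fun i => hprodM (fun c => μ c i) fun c => hμ c i)
    (by
      intro i p hp hpM'
      obtain ⟨c, rfl⟩ := hMp p hp hpM'
      rw [hMdef, ← Finset.mul_prod_erase _ _ (Finset.mem_univ c),
        ← Finset.mul_prod_erase _ (fun c => ϖ c ^ (E + 1)) (Finset.mem_univ c), ← mul_assoc,
        ← pow_succ']
      refine mul_dvd_mul (pow_dvd_pow _ (by have := hμ c i; lia)) ?_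
      exact Finset.prod_dvd_prod_of_dvd _ _ fun c _ =>
        pow_dvd_pow _ ((hμ c i).trans (Nat.le_succ E)))
    (by
      obtain ⟨c, hc⟩ := hsmall 2 Nat.prime_two (by lia)
      exact hc ▸ hpM c)
    (fun i => by
      obtain ⟨v, h1, h2⟩ := hv i
      exact ⟨v, h1, (hMco v h2).symm⟩)
    hD0 (fun e => hMco _ (hDϖ e)) hDD hD1
    (fun i j hij => ⟨_, hDeq (i, j) hij, Nat.Coprime.coprime_dvd_left
      (hprodM (fun c => min (μ c i) (μ c j)) fun c => (min_le_left _ _).trans (hμ c i))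
      (hMco _ (hDϖ _))⟩)
    (by
      intro e p hp hpe i j hij hmod
      rcases lt_or_gt_of_ne hij with h1 | h1
      · rw [hDcol e p hp hpe i j h1 hmod]
        exact ⟨Or.inl rfl, Or.inr rfl⟩
      · rw [hDcol e p hp hpe j i h1 hmod.symm]
        exact ⟨Or.inr rfl, Or.inl rfl⟩)
    hs0 hss hsM hsD (fun i p hp hps k => (hPle k).trans_lt (hsp i p hp hps))
  refine ⟨Q, m₀, P, fun i => (∏ c, ϖ c ^ μ c i) * (Z i * s i), hP, hm₀, ?_, hPle, ?_, hmain, ?_⟩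
  · have hs : ∀ i, s i ≤ 2 ^ H ^ 12 := by
      intro i
      refine (hsle i).trans ?_
      rw [← pow_add, ← pow_mul, ← pow_mul]
      refine Nat.pow_le_pow_right (by norm_num) ?_
      calc (N ^ 2 * H ^ 4 + H) * (H ^ 4 * N) ≤ (H ^ 2 * H ^ 4 + H ^ 6) * (H ^ 4 * H) := by
            gcongr
            exact Nat.le_self_pow (by norm_num) H
        _ = 2 * H ^ 11 := by ring
        _ ≤ H * H ^ 11 := Nat.mul_le_mul_right _ hH2
        _ = H ^ 12 := by ring
    have hs2 : ∏ i, s i ^ 2 ≤ 2 ^ (H ^ 12 * 2 * H) := by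
      rw [pow_mul]
      refine (Finset.prod_le_pow_card _ _ (2 ^ (H ^ 12 * 2)) fun i _ => ?_).trans
        (Nat.pow_le_pow_right Nat.one_le_two_pow (by simpa using hNH))
      rw [pow_mul]
      exact Nat.pow_le_pow_left (hs i) 2
    have hD2 : ∏ e, D e ^ 2 ≤ 2 ^ (H * 2 * H ^ 2) := by
      rw [pow_mul]
      refine (Finset.prod_le_pow_card _ _ (2 ^ (H * 2)) fun e _ => ?_).trans
        (Nat.pow_le_pow_right Nat.one_le_two_pow ?_)
      · rw [pow_mul]
        exact Nat.pow_le_pow_left (hDle e) 2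
      · rw [Finset.card_univ, Fintype.card_prod, Fintype.card_fin, ← sq]
        exact Nat.pow_le_pow_left hNH 2
    rw [hQ]
    refine (Nat.mul_le_mul hMle (Nat.mul_le_mul hD2 hs2)).trans ?_
    rw [← pow_add, ← pow_add]
    refine Nat.pow_le_pow_right (by norm_num) ?_
    have h1 : H ^ 1 ≤ H ^ 13 := Nat.pow_le_pow_right (by lia) (by norm_num)
    have h3 : 2 ^ 2 * H ^ 13 ≤ H ^ 2 * H ^ 13 := Nat.mul_le_mul_right _ (Nat.pow_le_pow_left hH2 2)
    have h6 : H + (H * 2 * H ^ 2 + H ^ 12 * 2 * H) = H + 2 * H ^ 3 + 2 * H ^ 13 := by ring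
    have h7 : H ^ 2 * H ^ 13 = H ^ 15 := by ring
    have h9 : 2 * H ^ 3 ≤ H ^ 13 := by
      have e1 : 2 * H ^ 3 ≤ H * H ^ 3 := Nat.mul_le_mul_right _ hH2
      have e2 : H * H ^ 3 = H ^ 4 := by ring
      have e3 : H ^ 4 ≤ H ^ 13 := Nat.pow_le_pow_right (by lia) (by norm_num)
      lia
    lia
  · intro p hp hpN
    obtain ⟨c, rfl⟩ := hsmall p hp hpN
    rw [hQ]
    exact (hpM c).mul_right _
  · intro i j hij
    have key : ∀ k, IsEndpoint k (i, j) → ∃ a,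
        (∏ c, ϖ c ^ μ c k) * (Z k * s k) = (P j - P i) * a ∧
        d a * d (D (i, j)) * ∏ c, (ν c k + 1) =
          (∏ c, (μ c k - min (μ c i) (μ c j) + 1)) *
            ∏ k, d ((∏ c, ϖ c ^ ν c k) * Z k) := by
      intro k hk
      set F := ∏ e ∈ (Finset.univ.filter (IsEndpoint k)).erase (i, j), D e with hF
      have hZF : Z k = D (i, j) * F := by
        rw [hZD]
        exact (Finset.mul_prod_erase _ _ (by simpa using hk)).symm
      have hle : ∀ c, min (μ c i) (μ c j) ≤ μ c k := by
        rcases hk with rfl | rfl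
        · exact fun c => min_le_left _ _
        · exact fun c => min_le_right _ _
      have hDF : (D (i, j)).Coprime F := Nat.Coprime.prod_right fun e he =>
        hDD (Finset.ne_of_mem_erase he).symm
      have hZs : (Z k).Coprime (s k) := by
        rw [hZD]
        exact Nat.Coprime.prod_left fun e _ => hsD e k
      have hFs : F.Coprime (s k) := Nat.Coprime.coprime_dvd_left
        (by rw [hZF]; exact dvd_mul_left _ _) hZs
      have hMF : M.Coprime F := Nat.Coprime.coprime_dvd_right
        (by rw [hZF]; exact dvd_mul_left _ _) (hMZ k)
      have hEM : ∏ c, ϖ c ^ (μ c k - min (μ c i) (μ c j)) ∣ M :=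
        hprodM (fun c => μ c k - min (μ c i) (μ c j)) fun c => (Nat.sub_le _ _).trans (hμ c k)
      refine ⟨(∏ c, ϖ c ^ (μ c k - min (μ c i) (μ c j))) * (F * s k), ?_, ?_⟩
      · have h1 : ∏ c, ϖ c ^ μ c k = (∏ c, ϖ c ^ min (μ c i) (μ c j)) *
            ∏ c, ϖ c ^ (μ c k - min (μ c i) (μ c j)) := by
          rw [← Finset.prod_mul_distrib]
          refine Finset.prod_congr rfl fun c _ => ?_
          rw [← pow_add, Nat.add_sub_cancel' (hle c)]
        rw [hDeq (i, j) hij, h1, hZF]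
        ring
      · rw [← hsd k]
        rw [d_mul (Nat.Coprime.coprime_dvd_left hEM (hMF.mul_right (hsM k))), d_mul hFs,
          d_mul (Nat.Coprime.coprime_dvd_left (hprodM (fun c => ν c k) fun c => hν c k) (hMZ k)),
          d_prod_prime_pow _ _ _ (fun c _ => hϖ c) hinj.injOn,
          d_prod_prime_pow _ _ _ (fun c _ => hϖ c) hinj.injOn, hZF, d_mul hDF]
        ring
    obtain ⟨a, ha, hda⟩ := key i (Or.inl rfl)
    obtain ⟨a', ha', hda'⟩ := key j (Or.inr rfl)
    refine ⟨a, a', ha, ha', card_divisors_ratio ?_ ?_ ?_ hda hda' ?_⟩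
    · exact Finset.prod_ne_zero_iff.2 fun c _ => Nat.succ_ne_zero _
    · exact Finset.prod_ne_zero_iff.2 fun c _ => Nat.succ_ne_zero _
    · simpa [d] using hD0 (i, j)
    · have e1 : ∀ c, μ c i - min (μ c i) (μ c j) = μ c i - μ c j := fun c => by lia
      have e2 : ∀ c, μ c j - min (μ c i) (μ c j) = μ c j - μ c i := fun c => by lia
      simp only [e1, e2, Nat.cast_prod]
      exact ht i j hij

theorem exists_large_nat_log_bound (K : ℕ) : ∃ N : ℕ, K ≤ N ∧
    128 * (4 * (5 + 4 * (16 * ((6 + 3 * N) * Real.log N))) + 36) < (N : ℝ) ^ 2 := by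
  have h1 := (Real.isLittleO_log_id_atTop.def (show (0 : ℝ) < 1 / 10 ^ 6 by norm_num)).natCast_atTop
  obtain ⟨N, hlog, hK⟩ := (h1.and (Filter.eventually_ge_atTop (max K 200))).exists
  refine ⟨N, le_of_max_le_left hK, ?_⟩
  have h200 : (200 : ℝ) ≤ N := by exact_mod_cast le_of_max_le_right hK
  have h2 : Real.log N ≤ 1 / 10 ^ 6 * N := by
    refine (Real.le_norm_self _).trans (hlog.trans_eq ?_)
    simp
  have h3 : (6 + 3 * N) * Real.log N ≤ (6 + 3 * N) * (1 / 10 ^ 6 * N) := by gcongr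
  nlinarith

theorem ratio_mem_R_of_linear_form_system {N J Q m X n₀ : ℕ} {P A : Fin N → ℕ} {t : ℚ} (hN : 8 ≤ N)
    (hNJ : N ≤ J) (hP : StrictMono P) (hQJ : Q ≤ 2 ^ J) (hmJ : m ≤ 2 ^ J) (hPX : ∀ i, P i ≤ X)
    (hXm : X * (n₀ + 1) < m) (hsmall : ∀ p, p.Prime → p ≤ 4 * N → p ∣ Q) (hQ : 0 < Q)
    (hA : ∀ i, (∃ b, m = P i + A i * b ∧ b.Coprime Q) ∧
      ∃ q, Q = A i * q ∧ ∀ p, p.Prime → p ∣ Q → p ∣ q)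
    (hAA : ∀ i j, i < j → ∃ a a', A i = (P j - P i) * a ∧ A j = (P j - P i) * a' ∧
      (d a : ℚ) = t * d a')
    (hlarge : 128 * (4 * (5 + 4 * Real.log J) + 36) < (N : ℝ) ^ 2) :
    ∃ n, n₀ < n ∧ (d (n + 1) : ℚ) / d n = t := by
  choose hb hq using hA
  choose b hb hbQ using hb
  choose q hq hpq using hq
  have hA0 : ∀ i, 0 < A i := fun i => Nat.pos_of_ne_zero fun h => by
    have := hq i
    rw [h, zero_mul] at this
    lia
  have hq0 : ∀ i, 0 < q i := fun i => Nat.pos_of_ne_zero fun h => by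
    have := hq i
    rw [h, mul_zero] at this
    lia
  have hQb : ∀ i p, p.Prime → p ∣ Q → ¬ p ∣ b i := fun i p hp h1 h2 =>
    hp.one_lt.ne' (Nat.dvd_one.1 (hbQ i ▸ Nat.dvd_gcd h2 h1))
  obtain ⟨x, i, j, hij, hd⟩ := exists_linear_forms_card_divisors_eq hN hNJ b q
    (fun i => by
      refine le_trans ?_ hmJ
      rw [hb i]
      exact (Nat.le_mul_of_pos_left _ (hA0 i)).trans (Nat.le_add_left _ _))
    (fun i => Nat.pos_of_ne_zero fun h => hQb i 2 Nat.prime_two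
      (hsmall 2 Nat.prime_two (by lia)) (h ▸ dvd_zero 2))
    (fun i => by
      refine le_trans ?_ hQJ
      conv_rhs => rw [hq i]
      exact Nat.le_mul_of_pos_left _ (hA0 i))
    hQb (fun i p hp => ⟨hpq i p hp, fun h => by
      rw [hq i]
      exact h.mul_left _⟩) hsmall hlarge
  obtain ⟨a, a', ha, ha', hda⟩ := hAA i j hij
  have hlt := hP hij
  set g := P j - P i with hg
  have hg0 : 0 < g := Nat.sub_pos_of_lt hlt
  have hco : ∀ k y, A k = g * y → y.Coprime (b k + q k * x) := fun k y hy =>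
    Nat.coprime_of_dvd fun p hp hpy hpb => by
      have h1 : p ∣ Q := by
        rw [hq k, hy]
        exact (hpy.mul_left g).mul_right _
      exact hQb k p hp h1 ((Nat.dvd_add_left ((hpq k p hp h1).mul_right x)).1 hpb)
  have hval : ∀ k y, A k = g * y → P k + g * (y * (b k + q k * x)) = m + Q * x := by
    intro k y hy
    calc P k + g * (y * (b k + q k * x)) = P k + g * y * b k + (g * y * q k) * x := by ring
      _ = m + Q * x := by rw [← hy, ← hb k, ← hq k]
  have hi := hval i a ha
  have hj := hval j a' ha'
  have hsucc : a' * (b j + q j * x) + 1 = a * (b i + q i * x) := by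
    refine Nat.eq_of_mul_eq_mul_left hg0 ?_
    rw [mul_add, mul_one]
    lia
  have hn₀ : n₀ < a' * (b j + q j * x) := by
    refine lt_of_mul_lt_mul_left (a := g) ?_ (Nat.zero_le _)
    have h1 : g ≤ X := (Nat.sub_le _ _).trans (hPX j)
    have h2 := Nat.mul_le_mul_right n₀ h1
    have h3 := hPX j
    rw [mul_add, mul_one] at hXm
    have h4 := Nat.zero_le (Q * x)
    lia
  refine ⟨a' * (b j + q j * x), hn₀, ?_⟩
  have h0 : a' * (b j + q j * x) ≠ 0 := by lia
  rw [hsucc, d_mul (hco i a ha), d_mul (hco j a' ha'), hd, Nat.cast_mul, Nat.cast_mul, hda]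
  have h1 : (d a' : ℚ) ≠ 0 := by simpa [d] using left_ne_zero_of_mul h0
  have h2 : (d (b j + q j * x) : ℚ) ≠ 0 := by simpa [d] using right_ne_zero_of_mul h0
  field_simp

theorem prod_ratioFactor_mem_R {Γ : Type} [Fintype Γ] (A B : Γ → ℕ) (up : Γ → Bool) :
    (∏ γ, if up γ then ratioFactor (A γ) (B γ) else (ratioFactor (A γ) (B γ))⁻¹) ∈ R := by
  classical
  refine Set.infinite_of_forall_exists_gt fun n₀ => ?_
  obtain ⟨N, hN, hlog⟩ := exists_large_nat_log_bound
    (Fintype.card Γ + 20 + n₀ + ∑ γ, (A γ + B γ))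
  have hE : ∀ γ, A γ + B γ ≤ N := fun γ => by
    have := Finset.single_le_sum (f := fun γ => A γ + B γ) (fun _ _ => Nat.zero_le _)
      (Finset.mem_univ γ)
    lia
  obtain ⟨κ, _, _, ϖ, μ, ν, hϖ, hinj, hcard, hϖle, hsmall, hμ, hν, hsep, ht⟩ :=
    exists_exponent_table A B up hE le_rfl (by lia)
  set h := 2 * N ^ 2 * (N + 1) * N ^ 2 with hh
  have hM : ∏ c, ϖ c ^ (N + 1) ≤ 2 ^ h := by
    rw [hh, pow_mul, pow_mul]
    refine (Finset.prod_le_pow_card _ _ _ fun c _ => Nat.pow_le_pow_left (hϖle c) _).trans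
      (Nat.pow_le_pow_right (Nat.one_le_pow _ _ (by positivity)) ?_)
    simpa using hcard
  have hh1 : 1 ≤ h := Nat.pos_of_ne_zero (by have : N ≠ 0 := by lia
                                             positivity)
  obtain ⟨Q, m₀, P, A', hP, hm₀, hQle, hPle, hQsmall, hA, hAA⟩ :=
    exists_linear_form_system hϖ hinj hμ hν hsep hsmall hM hh1 (by lia) ht
  set H := h * (N ^ 2 + 3) ^ N with hH
  have hHN : H ≤ N ^ (6 + 3 * N) := by
    have h1 : h ≤ N ^ 6 := by
      have : 2 * (N + 1) ≤ N * N := by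
        have := Nat.mul_le_mul_right N (by lia : 20 ≤ N)
        lia
      calc h = 2 * (N + 1) * N ^ 4 := by rw [hh]; ring
        _ ≤ N * N * N ^ 4 := Nat.mul_le_mul_right _ this
        _ = N ^ 6 := by ring
    have h2 : N ^ 2 + 3 ≤ N ^ 3 := by
      have : 20 * N ^ 2 ≤ N * N ^ 2 := Nat.mul_le_mul_right _ (by lia)
      have : N * N ^ 2 = N ^ 3 := by ring
      have : 1 ≤ N ^ 2 := Nat.one_le_pow _ _ (by lia)
      lia
    rw [hH, pow_add, pow_mul]
    exact Nat.mul_le_mul h1 (Nat.pow_le_pow_left h2 _)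
  have hNH : N ≤ H := by
    have h1 : N < 2 ^ N := Nat.lt_two_pow_self
    have h2 : 2 ^ N ≤ (N ^ 2 + 3) ^ N := Nat.pow_le_pow_left (by lia) _
    have h3 : (N ^ 2 + 3) ^ N ≤ H := Nat.le_mul_of_pos_left _ hh1
    lia
  have hJ : H ^ 15 + (H + N + 2) ≤ H ^ 16 := by
    have h1 : H ^ 1 ≤ H ^ 15 := Nat.pow_le_pow_right (by lia) (by norm_num)
    have h2 : 20 * H ^ 15 ≤ H * H ^ 15 := Nat.mul_le_mul_right _ (by lia)
    have h3 : H * H ^ 15 = H ^ 16 := by ring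
    lia
  have hmod : m₀ + Q * (2 ^ H * (n₀ + 1) + 1) ≡ m₀ [MOD Q] := Nat.add_mul_mod_self_left _ _ _
  have hQ0 : 0 < Q := by lia
  have hXm : 2 ^ H * (n₀ + 1) < m₀ + Q * (2 ^ H * (n₀ + 1) + 1) := by
    have := Nat.le_mul_of_pos_left (2 ^ H * (n₀ + 1) + 1) hQ0
    lia
  obtain ⟨n, hn, hdn⟩ := ratio_mem_R_of_linear_form_system (J := H ^ 16) (X := 2 ^ H) (n₀ := n₀)
    (m := m₀ + Q * (2 ^ H * (n₀ + 1) + 1)) (by lia) (hNH.trans (Nat.le_self_pow (by norm_num) H))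
    hP (hQle.trans (Nat.pow_le_pow_right (by norm_num) (by lia)))
    (by
      have h1 : m₀ + Q * (2 ^ H * (n₀ + 1) + 1) ≤ Q * (2 ^ H * (n₀ + 1) + 2) := by linarith
      have h2 : 2 ^ H * (n₀ + 1) + 2 ≤ 2 ^ (H + N + 2) := by
        have h3 : n₀ + 1 ≤ 2 ^ N := (by lia : n₀ + 1 ≤ N).trans Nat.lt_two_pow_self.le
        have h4 := Nat.mul_le_mul_left (2 ^ H) h3
        have h5 := Nat.one_le_two_pow (n := H + N)
        rw [← pow_add] at h4
        rw [pow_add _ (H + N)]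
        lia
      refine h1.trans ((Nat.mul_le_mul hQle h2).trans ?_)
      rw [← pow_add]
      exact Nat.pow_le_pow_right (by norm_num) hJ)
    hPle hXm hQsmall hQ0
    (fun i => ⟨(hA i).1 _ hmod (by
      have h1 := hPle i
      have h2 := Nat.le_mul_of_pos_right (2 ^ H) (Nat.succ_pos n₀)
      lia), (hA i).2⟩) hAA
    (by
      refine lt_of_le_of_lt ?_ hlog
      have h1 : Real.log H ≤ (6 + 3 * N) * Real.log N := by
        have h2 : Real.log H ≤ Real.log ((N : ℝ) ^ (6 + 3 * N)) :=
          Real.log_le_log (by exact_mod_cast (by lia : 0 < H)) (by exact_mod_cast hHN)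
        rw [Real.log_pow] at h2
        exact_mod_cast h2
      rw [Nat.cast_pow, Real.log_pow]
      push_cast
      gcongr)
  exact ⟨n, ⟨by lia, hdn⟩, hn⟩

/-- With `a = 4·∏ pᵢ^{xᵢ}·∏ qᵢ^{uᵢ}`, `(r₁, r₂, r₃) = (1, ∏ pᵢ^{yᵢ}, ∏ qᵢ^{vᵢ})`
for distinct odd primes `pᵢ, qᵢ` and positive exponents, and `a₁ = a`, `a₂ = a+1`,
`a₃ = a+2`: the `rᵢ` are pairwise coprime odd positive integers with
`gcd(rᵢ, aᵢ) = 1`, and consequently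
`(4/3)·∏ (xᵢ+1)(yᵢ+1)/(xᵢ+yᵢ+1) · ∏ (uᵢ+vᵢ+1)/((uᵢ+1)(vᵢ+1)) ∈ R`. -/
theorem stmt_10 (k l : ℕ) (p : Fin k → ℕ) (q : Fin l → ℕ)
    (hp : ∀ i, (p i).Prime) (hq : ∀ i, (q i).Prime)
    (hpodd : ∀ i, Odd (p i)) (hqodd : ∀ i, Odd (q i))
    (hpinj : Function.Injective p) (hqinj : Function.Injective q)
    (hpq : ∀ i j, p i ≠ q j)
    (x y : Fin k → ℕ) (u v : Fin l → ℕ)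
    (hx : ∀ i, 0 < x i) (hy : ∀ i, 0 < y i) (hu : ∀ i, 0 < u i) (hv : ∀ i, 0 < v i) :
    (letI a : ℕ := 4 * (∏ i, p i ^ x i) * (∏ i, q i ^ u i);
     letI r₁ : ℕ := 1;
     letI r₂ : ℕ := ∏ i, p i ^ y i;
     letI r₃ : ℕ := ∏ i, q i ^ v i;
     (0 < r₁ ∧ 0 < r₂ ∧ 0 < r₃) ∧
     (Odd r₁ ∧ Odd r₂ ∧ Odd r₃) ∧
     (Nat.Coprime r₁ r₂ ∧ Nat.Coprime r₁ r₃ ∧ Nat.Coprime r₂ r₃) ∧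
     (Nat.Coprime r₁ a ∧ Nat.Coprime r₂ (a + 1) ∧ Nat.Coprime r₃ (a + 2))) ∧
    (4 / 3 : ℚ) * (∏ i, ((x i + 1 : ℚ) * (y i + 1)) / (x i + y i + 1)) *
      (∏ i, ((u i + v i + 1 : ℚ)) / ((u i + 1) * (v i + 1))) ∈ R := by
  have hdvd : ∀ {m : ℕ} (f e : Fin m → ℕ), (∀ i, 0 < e i) → ∀ i, f i ∣ ∏ i, f i ^ e i :=
    fun f e he i => (dvd_pow_self _ (he i).ne').trans
      (Finset.dvd_prod_of_mem (fun i => f i ^ e i) (Finset.mem_univ i))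
  have hodd : ∀ {m : ℕ} (f e : Fin m → ℕ), (∀ i, Odd (f i)) → Odd (∏ i, f i ^ e i) :=
    fun f e hf => Finset.prod_induction _ Odd (fun _ _ => Odd.mul) odd_one fun i _ => (hf i).pow
  have hpos : ∀ {m : ℕ} (f e : Fin m → ℕ), (∀ i, (f i).Prime) → 0 < ∏ i, f i ^ e i :=
    fun f e hf => Finset.prod_pos fun i _ => pow_pos (hf i).pos _
  refine ⟨⟨⟨one_pos, hpos p y hp, hpos q v hq⟩, ⟨odd_one, hodd p y hpodd, hodd q v hqodd⟩,
    ⟨Nat.coprime_one_left _, Nat.coprime_one_left _, ?_⟩, Nat.coprime_one_left _, ?_, ?_⟩, ?_⟩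
  · exact Nat.Coprime.prod_left fun i _ => Nat.Coprime.prod_right fun j _ =>
      Nat.Coprime.pow _ _ ((Nat.coprime_primes (hp i) (hq j)).2 (hpq i j))
  · refine Nat.Coprime.prod_left fun i _ => Nat.Coprime.pow_left _ ?_
    have h : p i ∣ 4 * (∏ i, p i ^ x i) * ∏ i, q i ^ u i :=
      ((hdvd p x hx i).mul_left 4).mul_right _
    exact ((hp i).coprime_iff_not_dvd).2 fun h' => (hp i).one_lt.ne'
      (Nat.dvd_one.1 ((Nat.dvd_add_right h).1 h'))
  · refine Nat.Coprime.prod_left fun i _ => Nat.Coprime.pow_left _ ?_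
    have h : q i ∣ 4 * (∏ i, p i ^ x i) * ∏ i, q i ^ u i := (hdvd q u hu i).mul_left _
    refine ((hq i).coprime_iff_not_dvd).2 fun h' => ?_
    have h2 := (Nat.prime_dvd_prime_iff_eq (hq i) Nat.prime_two).1 ((Nat.dvd_add_right h).1 h')
    have h3 := hqodd i
    rw [h2] at h3
    exact absurd h3 (by decide)
  · have h := prod_ratioFactor_mem_R (Γ := Unit ⊕ Fin k ⊕ Fin l)
      (Sum.elim (fun _ => 1) (Sum.elim x u)) (Sum.elim (fun _ => 1) (Sum.elim y v))
      (Sum.elim (fun _ => true) (Sum.elim (fun _ => true) fun _ => false))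
    convert h using 1
    simp only [Fintype.prod_sum_type, Sum.elim_inl, Sum.elim_inr, Finset.univ_unique,
      Finset.prod_singleton, ratioFactor, if_true, Bool.false_eq_true, if_false, inv_div]
    norm_num [mul_assoc]
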